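/- arXiv:2204.03689 — 3 statements merged into one kernel-verified Lean document; each statement's English description precedes it below -/
import Mathlib

section
/- Fix a real m > 0 and a probability mass function p^0 on ℤ (so p^0_k ≥ 0 for all k and Σ_{k∈ℤ} p^0_k = 1). Define p^n inductively by p^{n+1}_k = p^n_k(1 − (p^n_k)^m) + (1/2)(p^n_{k+1})^{m+1} + (1/2)(p^n_{k−1})^{m+1}. Then for every x ∈ ℝ, lim_{n→∞} Σ_{k∈ℤ, k ≤ x·n^{1/(m+2)}} p^n_k = (1/B(a,a)) ∫_0^{min(max(1/2 + x/c_m, 0), 1)} y^{1/m}(1−y)^{1/m} dy, where a = (m+1)/m. Equivalently, if X_n has law p^n, then X_n/n^{1/(m+2)} converges in distribution to c_m(B − 1/2) where B is Beta(a, a)-distributed. -/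
open Filter MeasureTheory

/-- The Beta function `B(a,b) = Γ(a)Γ(b)/Γ(a+b)`. -/
noncomputable def betaFn (a b : ℝ) : ℝ := Real.Gamma a * Real.Gamma b / Real.Gamma (a + b)

/-- `ρ = m/(2(m+2))`. -/
noncomputable def rhoC (m : ℝ) : ℝ := m / (2 * (m + 2))

/-- `D = ρ^{-1/2} B(1/2, (m+1)/m)`. -/
noncomputable def DC (m : ℝ) : ℝ := rhoC m ^ (-(1 / 2) : ℝ) * betaFn (1 / 2) ((m + 1) / m)

/-- `c_m = 2^{(m+1)/(m+2)} (m+1)^{1/(m+2)} / (D^{m/(m+2)} ρ^{1/2})`. -/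
noncomputable def cC (m : ℝ) : ℝ :=
  (2 : ℝ) ^ ((m + 1) / (m + 2)) * (m + 1) ^ (1 / (m + 2)) /
    (DC m ^ (m / (m + 2)) * rhoC m ^ ((1 : ℝ) / 2))

/-- The CDF of `c_m (B - 1/2)` where `B` is Beta((m+1)/m, (m+1)/m)-distributed. -/
noncomputable def limitCDF (m x : ℝ) : ℝ :=
  (1 / betaFn ((m + 1) / m) ((m + 1) / m)) *
    ∫ y in (0 : ℝ)..(min (max (1 / 2 + x / cC m) 0) 1), y ^ (1 / m) * (1 - y) ^ (1 / m)

lemma rpow_add_one_of_nonneg {m x : ℝ} (hm : 0 < m) (hx : 0 ≤ x) : x ^ (m + 1) = x * x ^ m := by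
  rw [Real.rpow_add_one' hx (by linarith), mul_comm]

lemma one_lt_weighted_rpow {m r : ℝ} (hm : 0 < m) (hr0 : 0 ≤ r) (hr1 : r < 1) :
    1 < r * r ^ m + (1 - r) * (2 + r) ^ m := by
  rcases hr0.eq_or_lt with rfl | hr
  · have := Real.one_lt_rpow (show (1 : ℝ) < 2 by norm_num) hm
    simpa using this
  have h1 : 1 + Real.log r * m ≤ r ^ m := by
    rw [Real.rpow_def_of_pos hr]
    linarith [Real.add_one_le_exp (Real.log r * m)]
  have h2 : 1 + Real.log (2 + r) * m ≤ (2 + r) ^ m := by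
    rw [Real.rpow_def_of_pos (by linarith)]
    linarith [Real.add_one_le_exp (Real.log (2 + r) * m)]
  have h3 : -(1 - r ^ 2) / 2 ≤ r * Real.log r := by
    have hlog : 0 ≤ Real.log r⁻¹ := Real.log_nonneg ((one_le_inv₀ hr).2 hr1.le)
    have := Real.self_le_sinh_iff.2 hlog
    rw [Real.sinh_log (inv_pos.2 hr), Real.log_inv, inv_inv] at this
    have h4 := mul_le_mul_of_nonneg_left this hr.le
    have h5 : r * ((r⁻¹ - r) / 2) = (1 - r ^ 2) / 2 := by field_simp
    rw [h5] at h4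
    linarith
  have h4 : (1 + r) / 2 < Real.log (2 + r) := by
    have e : Real.log (2 + r) = Real.log 2 + Real.log (1 + r / 2) := by
      rw [← Real.log_mul (by norm_num) (by positivity)]
      ring_nf
    have h5 := Real.one_sub_inv_le_log_of_pos (show 0 < 1 + r / 2 by positivity)
    have h6 : 1 - (1 + r / 2)⁻¹ = r / (2 + r) := by field_simp; ring
    have h7 : r / 2 - 1 / 6 ≤ r / (2 + r) := by
      rw [le_div_iff₀ (by linarith)]
      nlinarith
    have := Real.log_two_gt_d9
    linarith
  have h5 : 0 < r * Real.log r + (1 - r) * Real.log (2 + r) := by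
    have := mul_lt_mul_of_pos_left h4 (sub_pos.2 hr1)
    nlinarith
  have h6 := mul_le_mul_of_nonneg_left h1 hr.le
  have h7 := mul_le_mul_of_nonneg_left h2 (sub_pos.2 hr1).le
  nlinarith

lemma one_le_weighted_rpow {m r : ℝ} (hm : 1 ≤ m) (hr0 : 0 ≤ r) (hr1 : r ≤ 1) :
    1 ≤ r * r ^ m + (1 - r) * (1 + r) ^ m := by
  have h := (convexOn_rpow hm).2 (x := r) hr0 (y := 1 + r) (by simp; linarith) hr0
    (sub_nonneg.2 hr1) (by ring)
  simp only [smul_eq_mul] at h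
  rwa [show r * r + (1 - r) * (1 + r) = 1 by ring, Real.one_rpow] at h

/-- If two numbers have sum at most one, then `x ↦ x - x ^ (m + 1)` is monotone on them. -/
lemma sub_rpow_le_sub_rpow {m c M : ℝ} (hm : 1 ≤ m) (hc : 0 ≤ c) (hcM : c ≤ M) (h1 : c + M ≤ 1) :
    c * (1 - c ^ m) ≤ M * (1 - M ^ m) := by
  rcases (hc.trans hcM).eq_or_lt with hM | hM
  · have : c = M := by linarith
    rw [this]
  obtain ⟨r, rfl⟩ : ∃ r, c = M * r := ⟨c / M, by field_simp⟩
  have hr0 : 0 ≤ r := nonneg_of_mul_nonneg_right hc hM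
  have hr1 : r ≤ 1 := by nlinarith
  have h2 := one_le_weighted_rpow hm hr0 hr1
  have h3 : (M * (1 + r)) ^ m ≤ 1 := Real.rpow_le_one (by positivity) (by linarith) (by linarith)
  rw [Real.mul_rpow hM.le (by linarith)] at h3
  rw [Real.mul_rpow hM.le hr0]
  have h4 : M ^ m * (1 - r * r ^ m) ≤ 1 - r := by
    have hMm : 0 ≤ M ^ m := by positivity
    have : M ^ m * (1 - r * r ^ m) ≤ M ^ m * ((1 - r) * (1 + r) ^ m) := by gcongr; linarith
    nlinarith
  nlinarith

lemma rpow_add_one_le_mul {m a M : ℝ} (hm : 0 < m) (ha : 0 ≤ a) (haM : a ≤ M) :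
    a ^ (m + 1) ≤ M ^ m * a := by
  rw [rpow_add_one_of_nonneg hm ha, mul_comm]
  gcongr

lemma step_lt_of_le_one {m a b c M : ℝ} (hm : 0 < m) (hm1 : m ≤ 1) (ha : 0 ≤ a) (hb : 0 ≤ b)
    (hc : 0 ≤ c) (haM : a ≤ M) (hbM : b ≤ M) (hcM : c ≤ M) (habc : a + b + c ≤ 1)
    (hM : 1 / 3 < M) :
    c * (1 - c ^ m) + (a ^ (m + 1) + b ^ (m + 1)) / 2 < M := by
  have hM0 : 0 < M := by linarith
  obtain ⟨r, rfl⟩ : ∃ r, c = M * r := ⟨c / M, by field_simp⟩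
  have hr0 : 0 ≤ r := nonneg_of_mul_nonneg_right hc hM0
  have hr1 : r ≤ 1 := by nlinarith
  have hMm : 0 < M ^ m := by positivity
  have hrm : 0 ≤ r ^ m := by positivity
  have ha1 := rpow_add_one_le_mul hm ha haM
  have hb1 := rpow_add_one_le_mul hm hb hbM
  rw [Real.mul_rpow hM0.le hr0]
  have key : r < 1 → (2 + r)⁻¹ ^ m * (1 - r * r ^ m) < 1 - r := by
    intro hr
    rw [Real.inv_rpow (by linarith), inv_mul_lt_iff₀ (by positivity)]
    linarith [one_lt_weighted_rpow hm hr0 hr]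
  have hr2 : 0 ≤ 1 - r * r ^ m := by
    have : r ^ m ≤ 1 := Real.rpow_le_one hr0 hr1 hm.le
    nlinarith
  rcases le_or_gt (M * (2 + r)) 1 with h | h
  · have hr : r < 1 := by nlinarith
    have h1 : M ≤ (2 + r)⁻¹ := by rw [← one_div, le_div_iff₀ (by linarith)]; exact h
    have h2 : M ^ m * (1 - r * r ^ m) ≤ (2 + r)⁻¹ ^ m * (1 - r * r ^ m) := by gcongr
    have h3 := h2.trans_lt (key hr)
    have h4 : M ^ m * a ≤ M ^ m * M := by gcongr
    have h5 : M ^ m * b ≤ M ^ m * M := by gcongr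
    nlinarith
  · have h1 : (2 + r)⁻¹ ≤ M := by rw [inv_le_iff_one_le_mul₀ (by linarith)]; exact h.le
    have e : M ^ m = M ^ (m - 1) * M := by
      rw [← Real.rpow_add_one hM0.ne']; ring_nf
    set N := M ^ (m - 1)
    have hN0 : 0 < N := by positivity
    have main : N * (1 / 2 - M * (r / 2 + r * r ^ m)) < 1 - r := by
      rcases hr1.eq_or_lt with rfl | hr
      · simp only [Real.one_rpow]
        nlinarith
      rcases le_or_gt (1 / 2 - M * (r / 2 + r * r ^ m)) 0 with h2 | h2
      · nlinarith
      · refine lt_of_le_of_lt ?_ (key hr)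
        have e2 : (2 + r)⁻¹ ^ m = (2 + r)⁻¹ ^ (m - 1) * (2 + r)⁻¹ := by
          rw [← Real.rpow_add_one (by positivity)]; ring_nf
        have h3 : N ≤ (2 + r)⁻¹ ^ (m - 1) :=
          Real.rpow_le_rpow_of_nonpos (by positivity) h1 (by linarith)
        have h4 : 1 / 2 - M * (r / 2 + r * r ^ m) ≤ 1 / 2 - (2 + r)⁻¹ * (r / 2 + r * r ^ m) := by
          gcongr
        calc N * (1 / 2 - M * (r / 2 + r * r ^ m))
            ≤ (2 + r)⁻¹ ^ (m - 1) * (1 / 2 - (2 + r)⁻¹ * (r / 2 + r * r ^ m)) := by gcongr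
          _ = (2 + r)⁻¹ ^ m * (1 - r * r ^ m) := by
            rw [e2]; field_simp; ring
    have h6 : M ^ m * (a + b) ≤ M ^ m * (1 - M * r) := by gcongr; linarith
    have h7 := mul_lt_mul_of_pos_left main hM0
    rw [e] at ha1 hb1 h6 ⊢
    nlinarith

lemma step_lt_of_one_le {m a b c M : ℝ} (hm : 1 ≤ m) (ha : 0 ≤ a) (hb : 0 ≤ b)
    (hc : 0 ≤ c) (haM : a ≤ M) (hbM : b ≤ M) (hcM : c ≤ M) (habc : a + b + c ≤ 1)
    (hM : 1 / 2 ≤ M) :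
    c * (1 - c ^ m) + (a ^ (m + 1) + b ^ (m + 1)) / 2 < M := by
  have hm0 : 0 < m := by linarith
  have hM0 : 0 < M := by linarith
  have hMe := rpow_add_one_of_nonneg hm0 hM0.le
  rcases le_or_gt (c + M) 1 with h | h
  · have h1 := sub_rpow_le_sub_rpow hm hc hcM h
    by_cases h2 : a = M ∧ b = M
    · obtain ⟨rfl, rfl⟩ := h2
      have hc0 : c = 0 := by linarith
      have : b ^ m < 1 := Real.rpow_lt_one ha (by linarith) hm0
      subst hc0
      nlinarith
    · have h3 : a ^ (m + 1) ≤ M ^ (m + 1) := by gcongr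
      have h4 : b ^ (m + 1) ≤ M ^ (m + 1) := by gcongr
      have h5 : a ^ (m + 1) + b ^ (m + 1) < 2 * M ^ (m + 1) := by
        rcases haM.lt_or_eq with h6 | h6
        · have : a ^ (m + 1) < M ^ (m + 1) := Real.rpow_lt_rpow ha h6 (by linarith)
          linarith
        · have h7 : b < M := lt_of_le_of_ne hbM fun h8 => h2 ⟨h6, h8⟩
          have : b ^ (m + 1) < M ^ (m + 1) := Real.rpow_lt_rpow hb h7 (by linarith)
          linarith
      nlinarith
  · have hc1 : 0 ≤ 1 - c := by linarith
    have h1 := rpow_add_one_le_mul hm0 ha (show a ≤ 1 - c by linarith)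
    have h2 := rpow_add_one_le_mul hm0 hb (show b ≤ 1 - c by linarith)
    have h3 : (1 - c) ^ m * (a + b) ≤ (1 - c) ^ m * (1 - c) := by gcongr; linarith
    have h5 : 0 ≤ (1 - c) ^ m := by positivity
    rcases le_or_gt c (1 / 2) with h4 | h4
    · have := sub_rpow_le_sub_rpow hm hc (show c ≤ 1 - c by linarith) (by linarith)
      nlinarith
    · have h6 : (1 - c) ^ m ≤ c ^ m := by gcongr; linarith
      have h7 : 0 < c ^ m := by positivity
      nlinarith

/-- One step of the scheme strictly decreases the peak above the monotonicity threshold. -/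
lemma step_lt {m a b c M : ℝ} (hm : 0 < m) (ha : 0 ≤ a) (hb : 0 ≤ b)
    (hc : 0 ≤ c) (haM : a ≤ M) (hbM : b ≤ M) (hcM : c ≤ M) (habc : a + b + c ≤ 1)
    (hM0 : 0 ≤ M) (hM : 1 ≤ (m + 1) * M ^ m) :
    c * (1 - c ^ m) + (a ^ (m + 1) + b ^ (m + 1)) / 2 < M := by
  rcases le_total m 1 with h | h
  · refine step_lt_of_le_one hm h ha hb hc haM hbM hcM habc ?_
    by_contra! hM3
    have h1 : M ^ m ≤ (1 / 3) ^ m := by gcongr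
    have h2 : 1 + m < 3 ^ m := by
      rw [Real.rpow_def_of_pos (by norm_num)]
      have h3 := Real.add_one_le_exp (Real.log 3 * m)
      have h4 : 1 < Real.log 3 := by
        rw [Real.lt_log_iff_exp_lt (by norm_num)]
        linarith [Real.exp_one_lt_d9]
      nlinarith
    rw [one_div, Real.inv_rpow (by norm_num)] at h1
    have h5 : (m + 1) * M ^ m ≤ (m + 1) * (3 ^ m)⁻¹ := by gcongr
    have h6 : (m + 1) * (3 ^ m)⁻¹ < 1 := by
      rw [← div_eq_mul_inv, div_lt_one (by positivity)]; linarith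
    linarith
  · refine step_lt_of_one_le h ha hb hc haM hbM hcM habc ?_
    by_contra! hM3
    have h1 : M ^ m < (1 / 2) ^ m := Real.rpow_lt_rpow hM0 hM3 hm
    have h2 : 1 + m ≤ 2 ^ m := by
      have := one_add_mul_self_le_rpow_one_add (show (-1 : ℝ) ≤ 1 by norm_num) h
      norm_num at this
      exact this
    rw [one_div, Real.inv_rpow (by norm_num)] at h1
    have h5 : (m + 1) * M ^ m < (m + 1) * (2 ^ m)⁻¹ := by gcongr
    have h6 : (m + 1) * (2 ^ m)⁻¹ ≤ 1 := by
      rw [← div_eq_mul_inv, div_le_one (by positivity)]; linarith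
    linarith

/-- Above the monotonicity threshold the peak decreases by a uniform amount. -/
lemma exists_step_le_sub {m u : ℝ} (hm : 0 < m) (hu : 0 ≤ u) (hum : 1 ≤ (m + 1) * u ^ m) :
    ∃ δ > 0, ∀ a b c M : ℝ, 0 ≤ a → 0 ≤ b → 0 ≤ c → a ≤ M → b ≤ M → c ≤ M → a + b + c ≤ 1 →
      u ≤ M → M ≤ 1 → c * (1 - c ^ m) + (a ^ (m + 1) + b ^ (m + 1)) / 2 ≤ M - δ := by
  let f : ℝ × ℝ × ℝ × ℝ → ℝ := fun q =>
    q.2.2.2 - (q.2.2.1 * (1 - q.2.2.1 ^ m) + (q.1 ^ (m + 1) + q.2.1 ^ (m + 1)) / 2)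
  let K : Set (ℝ × ℝ × ℝ × ℝ) :=
    (Set.Icc 0 1 ×ˢ Set.Icc 0 1 ×ˢ Set.Icc 0 1 ×ˢ Set.Icc u 1) ∩
      {q | q.1 ≤ q.2.2.2 ∧ q.2.1 ≤ q.2.2.2 ∧ q.2.2.1 ≤ q.2.2.2 ∧ q.1 + q.2.1 + q.2.2.1 ≤ 1}
  have hm' : 0 ≤ m + 1 := by linarith
  have hf : Continuous f := by
    have h1 : Continuous fun x : ℝ => x ^ m := Real.continuous_rpow_const hm.le
    have h2 : Continuous fun x : ℝ => x ^ (m + 1) := Real.continuous_rpow_const hm'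
    fun_prop
  have hK : IsCompact K := by
    refine (isCompact_Icc.prod (isCompact_Icc.prod (isCompact_Icc.prod isCompact_Icc))).inter_right ?_
    exact (isClosed_le continuous_fst (by fun_prop)).and
      ((isClosed_le (by fun_prop) (by fun_prop)).and
      ((isClosed_le (by fun_prop) (by fun_prop)).and (isClosed_le (by fun_prop) (by fun_prop))))
  have hpos : ∀ q ∈ K, 0 < f q := by
    rintro ⟨a, b, c, M⟩ ⟨⟨ha, hb, hc, hM⟩, h1, h2, h3, h4⟩
    simp only at *
    refine sub_pos.2 (step_lt hm ha.1 hb.1 hc.1 h1 h2 h3 h4 (hu.trans hM.1) ?_)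
    refine hum.trans ?_
    have := hM.1
    gcongr
  have hmem : ∀ a b c M : ℝ, 0 ≤ a → 0 ≤ b → 0 ≤ c → a ≤ M → b ≤ M → c ≤ M → a + b + c ≤ 1 →
      u ≤ M → M ≤ 1 → (a, b, c, M) ∈ K := fun a b c M ha hb hc h1 h2 h3 h4 h5 h6 =>
    ⟨⟨⟨ha, h1.trans h6⟩, ⟨hb, h2.trans h6⟩, ⟨hc, h3.trans h6⟩, ⟨h5, h6⟩⟩, h1, h2, h3, h4⟩
  rcases K.eq_empty_or_nonempty with hE | hne
  · refine ⟨1, one_pos, fun a b c M ha hb hc h1 h2 h3 h4 h5 h6 => ?_⟩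
    have := hmem a b c M ha hb hc h1 h2 h3 h4 h5 h6
    simp [hE] at this
  · obtain ⟨q, hq, hmin⟩ := hK.exists_isMinOn hne hf.continuousOn
    refine ⟨f q, hpos q hq, fun a b c M ha hb hc h1 h2 h3 h4 h5 h6 => ?_⟩
    have := hmin (hmem a b c M ha hb hc h1 h2 h3 h4 h5 h6)
    simp only [Set.mem_ofPred_eq, f] at this ⊢
    linarith

/-- Partial sums `∑_{j ≤ k} f j` of a family indexed by the integers. -/
noncomputable def cdfSum (f : ℤ → ℝ) (k : ℤ) : ℝ := ∑' j : ℤ, if j ≤ k then f j else 0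

lemma summable_ite_le {f : ℤ → ℝ} (hf : Summable f) (k : ℤ) :
    Summable fun j : ℤ => if j ≤ k then f j else 0 := by
  refine (hf.indicator (Set.Iic k)).congr fun j => ?_
  simp [Set.indicator_apply]

lemma hasSum_cdfSum {f : ℤ → ℝ} (hf : Summable f) (k : ℤ) :
    HasSum (fun j : ℤ => if j ≤ k then f j else 0) (cdfSum f k) :=
  (summable_ite_le hf k).hasSum

lemma cdfSum_add_one {f : ℤ → ℝ} (hf : Summable f) (k : ℤ) :
    cdfSum f (k + 1) = cdfSum f k + f (k + 1) := by
  have h := (hasSum_cdfSum hf k).add (hasSum_ite_eq (k + 1) (f (k + 1)))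
  refine (hasSum_cdfSum hf (k + 1)).unique (h.congr_fun fun j => ?_)
  rcases lt_trichotomy j (k + 1) with h1 | h1 | h1
  · simp [h1.le, h1.ne, Int.lt_add_one_iff.1 h1]
  · simp [h1]
  · simp [not_le.2 h1, h1.ne', not_le.2 ((lt_add_one k).trans h1)]

lemma hasSum_shift {f : ℤ → ℝ} (hf : Summable f) (k i : ℤ) :
    HasSum (fun j : ℤ => if j ≤ k then f (j + i) else 0) (cdfSum f (k + i)) := by
  have h := (Equiv.addRight i).hasSum_iff.2 (hasSum_cdfSum hf (k + i))
  refine h.congr_fun fun j => ?_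
  simp

lemma tendsto_cdfSum_atTop {f : ℤ → ℝ} {s : ℝ} (hf : HasSum f s) :
    Tendsto (cdfSum f) atTop (nhds s) := by
  rw [← hf.tsum_eq]
  refine tendsto_tsum_of_dominated_convergence hf.summable.norm (fun j => ?_) ?_
  · refine tendsto_const_nhds.congr' ?_
    filter_upwards [eventually_ge_atTop j] with k hk
    simp [hk]
  · refine Eventually.of_forall fun k j => ?_
    split_ifs <;> simp

lemma tendsto_cdfSum_atBot {f : ℤ → ℝ} (hf : Summable f) :
    Tendsto (cdfSum f) atBot (nhds 0) := by
  rw [← tsum_zero (α := ℝ) (β := ℤ)]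
  refine tendsto_tsum_of_dominated_convergence hf.norm (fun j => ?_) ?_
  · refine tendsto_const_nhds.congr' ?_
    filter_upwards [eventually_lt_atBot j] with k hk
    simp [hk]
  · refine Eventually.of_forall fun k j => ?_
    split_ifs <;> simp

lemma cdfSum_nonneg {f : ℤ → ℝ} (hf : ∀ k, 0 ≤ f k) (k : ℤ) : 0 ≤ cdfSum f k :=
  tsum_nonneg fun j => by split_ifs <;> simp [hf]

lemma cdfSum_le {f : ℤ → ℝ} {s : ℝ} (h0 : ∀ k, 0 ≤ f k) (hf : HasSum f s) (k : ℤ) :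
    cdfSum f k ≤ s :=
  hasSum_le (fun j => by split_ifs <;> simp [h0]) (hasSum_cdfSum hf.summable k) hf

lemma add_add_le_of_hasSum {f : ℤ → ℝ} (h0 : ∀ k, 0 ≤ f k) (hf : HasSum f 1) (k : ℤ) :
    f (k + 1) + f (k - 1) + f k ≤ 1 := by
  have h := sum_le_hasSum {k + 1, k - 1, k} (fun i _ => h0 i) hf
  rw [Finset.sum_insert, Finset.sum_pair] at h
  · linarith
  · lia
  · simp only [Finset.mem_insert, Finset.mem_singleton]; lia

lemma summable_rpow {m : ℝ} (hm : 0 < m) {f : ℤ → ℝ} (h0 : ∀ k, 0 ≤ f k) (h1 : ∀ k, f k ≤ 1)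
    (hf : Summable f) : Summable fun k => f k ^ (m + 1) :=
  hf.of_nonneg_of_le (fun k => Real.rpow_nonneg (h0 k) _) fun k =>
    Real.rpow_le_self_of_le_one (h0 k) (h1 k) (by linarith)

section Scheme

variable {m : ℝ} {p : ℕ → ℤ → ℝ}

/-- The recursion of the scheme. -/
def IsScheme (m : ℝ) (p : ℕ → ℤ → ℝ) : Prop :=
  ∀ (n : ℕ) (k : ℤ), p (n + 1) k =
    p n k * (1 - p n k ^ m) + (1 / 2) * p n (k + 1) ^ (m + 1) + (1 / 2) * p n (k - 1) ^ (m + 1)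

lemma IsScheme.eq_add (hrec : IsScheme m p) (hm : 0 < m) {n : ℕ} (h0 : ∀ k, 0 ≤ p n k) (k : ℤ) :
    p (n + 1) k = p n k - p n k ^ (m + 1) + (1 / 2) * p n (k + 1) ^ (m + 1)
      + (1 / 2) * p n (k + -1) ^ (m + 1) := by
  rw [hrec n k, rpow_add_one_of_nonneg hm (h0 k), sub_eq_add_neg k 1]
  ring

lemma IsScheme.nonneg_and_hasSum (hrec : IsScheme m p) (hm : 0 < m) (h0 : ∀ k, 0 ≤ p 0 k)
    (hs : HasSum (p 0) 1) (n : ℕ) : (∀ k, 0 ≤ p n k) ∧ HasSum (p n) 1 := by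
  induction n with
  | zero => exact ⟨h0, hs⟩
  | succ n ih =>
    obtain ⟨ih0, ihs⟩ := ih
    have ih1 : ∀ k, p n k ≤ 1 := fun k => le_hasSum ihs k fun j _ => ih0 j
    refine ⟨fun k => ?_, ?_⟩
    · rw [hrec n k]
      have h1 : p n k ^ m ≤ 1 := Real.rpow_le_one (ih0 k) (ih1 k) hm.le
      have h2 := Real.rpow_nonneg (ih0 (k + 1)) (m + 1)
      have h3 := Real.rpow_nonneg (ih0 (k - 1)) (m + 1)
      have h4 := mul_nonneg (ih0 k) (sub_nonneg.2 h1)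
      linarith
    · have hg := (summable_rpow hm ih0 ih1 ihs.summable).hasSum
      have hg1 := (Equiv.addRight (1 : ℤ)).hasSum_iff.2 hg
      have hg2 := (Equiv.addRight (-1 : ℤ)).hasSum_iff.2 hg
      have h := ((ihs.sub hg).add (hg1.mul_left (1 / 2))).add (hg2.mul_left (1 / 2))
      rw [show ∀ G : ℝ, 1 - G + 1 / 2 * G + 1 / 2 * G = 1 from fun G => by ring] at h
      exact h.congr_fun fun k => by simpa using hrec.eq_add hm ih0 k

lemma IsScheme.cdfSum_succ (hrec : IsScheme m p) (hm : 0 < m) (h0 : ∀ k, 0 ≤ p 0 k)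
    (hs : HasSum (p 0) 1) (n : ℕ) (k : ℤ) :
    cdfSum (p (n + 1)) k =
      cdfSum (p n) k + (1 / 2) * (p n (k + 1) ^ (m + 1) - p n k ^ (m + 1)) := by
  obtain ⟨ih0, ihs⟩ := hrec.nonneg_and_hasSum hm h0 hs n
  have ih1 : ∀ k, p n k ≤ 1 := fun k => le_hasSum ihs k fun j _ => ih0 j
  have hg := summable_rpow hm ih0 ih1 ihs.summable
  have h := (((hasSum_cdfSum ihs.summable k).sub (hasSum_cdfSum hg k)).add
    ((hasSum_shift hg k 1).mul_left (1 / 2))).add ((hasSum_shift hg k (-1)).mul_left (1 / 2))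
  have h2 := (hasSum_cdfSum (hrec.nonneg_and_hasSum hm h0 hs (n + 1)).2.summable k).unique
    (h.congr_fun fun j => by split_ifs <;> simp [hrec.eq_add hm ih0 j])
  have h3 := cdfSum_add_one hg k
  have h4 := cdfSum_add_one hg (k + -1)
  simp only [neg_add_cancel_right] at h4
  rw [h2, h3]
  linarith

lemma IsScheme.eventually_le (hrec : IsScheme m p) (hm : 0 < m) (h0 : ∀ k, 0 ≤ p 0 k)
    (hs : HasSum (p 0) 1) {u : ℝ} (hu : 0 ≤ u) (hu1 : u ≤ 1) (hum : 1 ≤ (m + 1) * u ^ m) :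
    ∃ N, ∀ n, N ≤ n → ∀ k, p n k ≤ u := by
  obtain ⟨δ, hδ, H⟩ := exists_step_le_sub hm hu hum
  have key : ∀ (n : ℕ) (k : ℤ), p n k ≤ max u (1 - n * δ) := by
    intro n
    induction n with
    | zero =>
      intro k
      refine le_max_of_le_right ?_
      simpa using le_hasSum hs k fun j _ => h0 j
    | succ n ih =>
      intro k
      obtain ⟨ih0, ihs⟩ := hrec.nonneg_and_hasSum hm h0 hs n
      have h1 := H (p n (k + 1)) (p n (k - 1)) (p n k) (max u (1 - n * δ)) (ih0 _) (ih0 _) (ih0 _)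
        (ih _) (ih _) (ih _) (add_add_le_of_hasSum ih0 ihs k) (le_max_left _ _)
        (max_le hu1 (by nlinarith [Nat.cast_nonneg (α := ℝ) n]))
      rw [hrec n k]
      push_cast
      rcases max_cases u (1 - n * δ) with ⟨h2, -⟩ | ⟨h2, -⟩
      · refine le_max_of_le_left ?_
        linarith
      · refine le_max_of_le_right ?_
        linarith
  obtain ⟨N, hN⟩ := exists_nat_ge (1 / δ)
  refine ⟨N, fun n hn k => (key n k).trans (max_le le_rfl ?_)⟩
  rw [div_le_iff₀ hδ] at hN
  have : (N : ℝ) * δ ≤ n * δ := by gcongr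
  linarith

end Scheme

/-- Below the threshold `(m + 1) u ^ m ≤ 1` the flux `x ↦ x ^ (m + 1)` is `1`-Lipschitz. -/
lemma rpow_sub_rpow_le {m u a b : ℝ} (hm : 0 < m) (hum : (m + 1) * u ^ m ≤ 1) (hb : 0 ≤ b)
    (hba : b ≤ a) (hau : a ≤ u) : a ^ (m + 1) - b ^ (m + 1) ≤ a - b := by
  rcases (hb.trans hba).eq_or_lt with ha | ha
  · have : b = a := by linarith
    simp [this]
  obtain ⟨r, rfl⟩ : ∃ r, b = a * r := ⟨b / a, by field_simp⟩
  have hr0 : 0 ≤ r := nonneg_of_mul_nonneg_right hb ha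
  have hr1 : r ≤ 1 := by nlinarith
  have h1 := one_add_mul_self_le_rpow_one_add (show -1 ≤ r - 1 by linarith)
    (show 1 ≤ m + 1 by linarith)
  rw [show 1 + (r - 1) = r by ring] at h1
  have h2 : (m + 1) * a ^ m ≤ 1 := by
    refine le_trans ?_ hum
    gcongr
  rw [Real.mul_rpow ha.le hr0, rpow_add_one_of_nonneg hm ha.le]
  have h3 : 0 ≤ a ^ m := by positivity
  have h4 : a ^ m * (1 - r ^ (m + 1)) ≤ a ^ m * ((m + 1) * (1 - r)) := by gcongr; linarith
  nlinarith

/-- Comparison principle in the supremum norm for the integrated scheme. -/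
lemma scheme_comparison {m u ε : ℝ} (hm : 0 < m) (hum : (m + 1) * u ^ m ≤ 1)
    {A B : ℕ → ℤ → ℝ} {e : ℕ → ℝ}
    (hA0 : ∀ n k, 0 ≤ A n (k + 1) - A n k) (hAu : ∀ n k, A n (k + 1) - A n k ≤ u)
    (hB0 : ∀ n k, 0 ≤ B n (k + 1) - B n k) (hBu : ∀ n k, B n (k + 1) - B n k ≤ u)
    (hstep : ∀ n k,
      A (n + 1) k - (A n k + 1 / 2 * ((A n (k + 1) - A n k) ^ (m + 1)
        - (A n k - A n (k - 1)) ^ (m + 1))) ≤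
      B (n + 1) k - (B n k + 1 / 2 * ((B n (k + 1) - B n k) ^ (m + 1)
        - (B n k - B n (k - 1)) ^ (m + 1))) + e n)
    (hinit : ∀ k, A 0 k ≤ B 0 k + ε) (n : ℕ) (k : ℤ) :
    A n k ≤ B n k + ε + ∑ j ∈ Finset.range n, e j := by
  have lip : ∀ c c' δ : ℝ, 0 ≤ c → c ≤ u → 0 ≤ c' → c - c' ≤ δ → 0 ≤ δ →
      c ^ (m + 1) - c' ^ (m + 1) ≤ δ := by
    intro c c' δ h1 h2 h3 h4 h5
    rcases le_total c' c with h | h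
    · exact (rpow_sub_rpow_le hm hum h3 h h2).trans h4
    · have : c ^ (m + 1) ≤ c' ^ (m + 1) := by gcongr
      linarith
  induction n generalizing k with
  | zero => simpa using hinit k
  | succ n ih =>
    rw [Finset.sum_range_succ]
    have i0 := ih k
    have i1 := ih (k + 1)
    have i2 := ih (k - 1)
    set E := ∑ j ∈ Finset.range n, e j
    have hA' := hA0 n (k - 1)
    have hB' := hB0 n (k - 1)
    have hAu' := hAu n (k - 1)
    have hBu' := hBu n (k - 1)
    rw [sub_add_cancel] at hA' hB' hAu' hBu'
    have l1 := lip _ _ (B n k + ε + E - A n k) (hA0 n k) (hAu n k) (hB0 n k)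
      (by linarith) (by linarith)
    have l2 := lip _ _ (B n k + ε + E - A n k) hB' hBu' hA' (by linarith) (by linarith)
    have := hstep n k
    linarith

lemma add_mul_sub_le_rpow {m x v : ℝ} (hm : 0 < m) (hx : 0 ≤ x) (hv : 0 ≤ v) :
    v ^ (m + 1) + (m + 1) * v ^ m * (x - v) ≤ x ^ (m + 1) := by
  rcases hv.eq_or_lt with rfl | hv
  · rw [Real.zero_rpow (by linarith), Real.zero_rpow hm.ne']
    simpa using Real.rpow_nonneg hx _
  obtain ⟨r, rfl⟩ : ∃ r, x = v * r := ⟨x / v, by field_simp⟩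
  have hr0 : 0 ≤ r := nonneg_of_mul_nonneg_right hx hv
  have h1 := one_add_mul_self_le_rpow_one_add (show -1 ≤ r - 1 by linarith)
    (show 1 ≤ m + 1 by linarith)
  rw [show 1 + (r - 1) = r by ring] at h1
  rw [Real.mul_rpow hv.le hr0]
  have h2 : v ^ (m + 1) * (1 + (m + 1) * (r - 1)) ≤ v ^ (m + 1) * r ^ (m + 1) := by gcongr
  rw [rpow_add_one_of_nonneg hm hv.le] at *
  linarith

lemma abs_rpow_taylor_le {m u v : ℝ} (hm : 0 < m) (hu : 0 ≤ u) (hv : 0 ≤ v) :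
    |u ^ (m + 1) - v ^ (m + 1) - (m + 1) * v ^ m * (u - v)| ≤
      (m + 1) * (|u ^ m - v ^ m| * |u - v|) := by
  have h1 := add_mul_sub_le_rpow hm hu hv
  have h2 := add_mul_sub_le_rpow hm hv hu
  rw [abs_of_nonneg (by linarith), ← abs_mul]
  have h3 : (m + 1) * ((u ^ m - v ^ m) * (u - v)) ≤ (m + 1) * |(u ^ m - v ^ m) * (u - v)| := by
    gcongr
    exact le_abs_self _
  linarith

lemma abs_sub_le_of_hasDerivAt {f f' : ℝ → ℝ} {a h B : ℝ} (hh : 0 ≤ h)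
    (hf : ∀ s, HasDerivAt f (f' s) s) (hB : ∀ s ∈ Set.Icc a (a + h), |f' s| ≤ B) :
    |f (a + h) - f a| ≤ B * h := by
  have := norm_image_sub_le_of_norm_deriv_le_segment' (f := f) (f' := f') (a := a) (b := a + h)
    (C := B) (fun s _ => (hf s).hasDerivWithinAt)
    (fun s hs => hB s (Set.Ico_subset_Icc_self hs)) (a + h) ⟨by linarith, le_rfl⟩
  simpa using this

/-- A self-similar solution of the porous medium equation `∂ₜ u = ½ ∂ₓₓ u ^ (m + 1)`: the function
`F` is the density profile and `Ψ` its primitive. -/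
structure IsProfile (m θ C r K : ℝ) (Ψ F : ℝ → ℝ) : Prop where
  hasDerivAt (y : ℝ) : HasDerivAt Ψ (F y) y
  nonneg (y : ℝ) : 0 ≤ F y
  le (y : ℝ) : F y ≤ K
  hasDerivAt_rpow (y : ℝ) :
    HasDerivAt (fun y => F y ^ (m + 1)) (-(2 * (1 / (m + 2))) * (y * F y)) y
  holder (x y : ℝ) : |F x - F y| ≤ C * |x - y| ^ θ
  holder_mul (x y : ℝ) : |x * F x - y * F y| ≤ C * |x - y| ^ θ
  lipschitz (x y : ℝ) : |F x ^ m - F y ^ m| ≤ C * |x - y|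
  eq_zero (y : ℝ) : r ≤ |y| → F y = 0
  const_nonneg : 0 ≤ C
  radius_pos : 0 < r
  exponent_pos : 0 < θ
  exponent_le_one : θ ≤ 1

namespace IsProfile

variable {m θ C r K : ℝ} {Ψ F : ℝ → ℝ}

lemma average_gap (P : IsProfile m θ C r K Ψ F) (hm : 0 < m) {Φ : ℝ → ℝ}
    (hΦ : ∀ y, HasDerivAt Φ (F y ^ (m + 1)) y) {h : ℝ} (hh : 0 < h) (y : ℝ) :
    |Φ (y + h) - Φ y - h * ((Ψ (y + h) - Ψ y) / h) ^ (m + 1)| ≤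
      (m + 1) * C ^ 2 * (h ^ 2 * h ^ θ) := by
  obtain ⟨ξ, hξ, hv⟩ := exists_hasDerivAt_eq_slope Ψ F (show y < y + h by linarith)
    (fun s _ => (P.hasDerivAt s).continuousAt.continuousWithinAt) (fun s _ => P.hasDerivAt s)
  rw [add_sub_cancel_left] at hv
  rw [← hv]
  have hd : ∀ s, HasDerivAt
      (fun s => Φ s - F ξ ^ (m + 1) * s - (m + 1) * F ξ ^ m * (Ψ s - F ξ * s))
      (F s ^ (m + 1) - F ξ ^ (m + 1) - (m + 1) * F ξ ^ m * (F s - F ξ)) s := by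
    intro s
    have hid := hasDerivAt_id' s
    convert! ((hΦ s).sub (hid.const_mul (F ξ ^ (m + 1)))).sub
      (((P.hasDerivAt s).sub (hid.const_mul (F ξ))).const_mul ((m + 1) * F ξ ^ m)) using 1
    ring
  have hC := P.const_nonneg
  have hB := abs_sub_le_of_hasDerivAt (a := y) (B := (m + 1) * ((C * h) * (C * h ^ θ))) hh.le hd
    (fun s hs => by
      refine (abs_rpow_taylor_le hm (P.nonneg s) (P.nonneg ξ)).trans ?_
      have hs' : |s - ξ| ≤ h := by
        rw [abs_le]
        constructor <;> linarith [hs.1, hs.2, hξ.1, hξ.2]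
      have hθ := P.exponent_pos
      gcongr
      · exact (P.lipschitz s ξ).trans (by gcongr)
      · exact (P.holder s ξ).trans (by gcongr))
  have e : Ψ (y + h) - Ψ y = F ξ * h := by rw [hv]; field_simp
  refine le_trans (le_of_eq ?_) (hB.trans (le_of_eq (by ring)))
  congr 1
  rw [show ∀ A B : ℝ, Φ (y + h) - A * (y + h) - B * (Ψ (y + h) - F ξ * (y + h)) -
    (Φ y - A * y - B * (Ψ y - F ξ * y)) =
      Φ (y + h) - Φ y - A * h - B * (Ψ (y + h) - Ψ y - F ξ * h) from fun A B => by ring, e]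
  ring

lemma second_difference (P : IsProfile m θ C r K Ψ F) (hm : 0 < m) {Φ : ℝ → ℝ}
    (hΦ : ∀ y, HasDerivAt Φ (F y ^ (m + 1)) y) {h : ℝ} (hh : 0 < h) (y : ℝ) :
    |Φ (y + h) + Φ (y - h) - 2 * Φ y + 2 * (1 / (m + 2)) * (y * F y) * h ^ 2| ≤
      4 * C * (h ^ 2 * h ^ θ) := by
  set b := 2 * (1 / (m + 2)) with hb
  have hb0 : 0 ≤ b := by positivity
  have hb1 : b ≤ 1 := by
    rw [hb, mul_one_div, div_le_one (by linarith)]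
    linarith
  have hC := P.const_nonneg
  have hθ := P.exponent_pos
  have hh2 : 0 ≤ h ^ θ := by positivity
  have hadd : ∀ s : ℝ, HasDerivAt (fun s => y + s) 1 s := fun s => (hasDerivAt_id' s).const_add y
  have hsub : ∀ s : ℝ, HasDerivAt (fun s => y - s) (-1) s := fun s => (hasDerivAt_id' s).const_sub y
  have hd1 : ∀ s, HasDerivAt
      (fun s => F (y + s) ^ (m + 1) - F (y - s) ^ (m + 1) + 2 * (b * (y * F y)) * s)
      (-b * ((y + s) * F (y + s)) - (-b * ((y - s) * F (y - s))) * (-1)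
        + 2 * (b * (y * F y)) * 1) s := by
    intro s
    exact (((P.hasDerivAt_rpow (y + s)).comp s (hadd s) |>.congr_deriv (mul_one _)).sub
      ((P.hasDerivAt_rpow (y - s)).comp s (hsub s))).add ((hasDerivAt_id' s).const_mul _)
  have h1 : ∀ s ∈ Set.Icc (0 : ℝ) (0 + h),
      |F (y + s) ^ (m + 1) - F (y - s) ^ (m + 1) + 2 * (b * (y * F y)) * s| ≤
        2 * C * h ^ θ * h := by
    intro s hs
    rw [zero_add] at hs
    have := abs_sub_le_of_hasDerivAt (a := 0) (B := 2 * C * h ^ θ) hs.1 hd1 (fun t ht => by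
      rw [zero_add] at ht
      have k1 := P.holder_mul (y + t) y
      have k2 := P.holder_mul (y - t) y
      rw [add_sub_cancel_left, abs_of_nonneg ht.1] at k1
      rw [sub_sub_cancel_left, abs_neg, abs_of_nonneg ht.1] at k2
      have k3 : C * t ^ θ ≤ C * h ^ θ := by
        have := ht.1
        have := ht.2.trans hs.2
        gcongr
      rw [show -b * ((y + t) * F (y + t)) - (-b * ((y - t) * F (y - t))) * (-1)
        + 2 * (b * (y * F y)) * 1 = -b * (((y + t) * F (y + t) - y * F y)
          + ((y - t) * F (y - t) - y * F y)) by ring, abs_mul, abs_neg, abs_of_nonneg hb0]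
      have k4 := abs_add_le ((y + t) * F (y + t) - y * F y) ((y - t) * F (y - t) - y * F y)
      have k5 := mul_le_mul_of_nonneg_right hb1
        (abs_nonneg ((y + t) * F (y + t) - y * F y + ((y - t) * F (y - t) - y * F y)))
      linarith)
    simp only [zero_add, add_zero, sub_zero, mul_zero, sub_self] at this
    refine this.trans ?_
    have := hs.2
    gcongr
  have hd2 : ∀ s, HasDerivAt
      (fun s => Φ (y + s) + Φ (y - s) + (b * (y * F y)) * s ^ 2)
      (F (y + s) ^ (m + 1) - F (y - s) ^ (m + 1) + 2 * (b * (y * F y)) * s) s := by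
    intro s
    convert! (((hΦ (y + s)).comp s (hadd s)).add ((hΦ (y - s)).comp s (hsub s))).add
      ((hasDerivAt_pow 2 s).const_mul (b * (y * F y))) using 1
    simp
    ring
  have h2 := abs_sub_le_of_hasDerivAt hh.le hd2 h1
  simp only [zero_add, add_zero, sub_zero] at h2
  refine le_trans (le_of_eq ?_) (h2.trans ?_)
  · congr 1
    ring
  · have : 0 ≤ C * (h ^ 2 * h ^ θ) := by positivity
    linarith

lemma flux_difference (P : IsProfile m θ C r K Ψ F) (hm : 0 < m) {h : ℝ} (hh : 0 < h) (y : ℝ) :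
    |1 / 2 * ((Ψ (y + h) - Ψ y) ^ (m + 1) - (Ψ y - Ψ (y - h)) ^ (m + 1))
      + 1 / (m + 2) * (y * F y) * h ^ (m + 2)| ≤
      ((m + 1) * C ^ 2 + 2 * C) * (h ^ (m + 2) * h ^ θ) := by
  have hcont : Continuous fun y => F y ^ (m + 1) :=
    continuous_iff_continuousAt.2 fun y => (P.hasDerivAt_rpow y).continuousAt
  have hΦ : ∀ y, HasDerivAt (fun y => ∫ s in (0 : ℝ)..y, F s ^ (m + 1)) (F y ^ (m + 1)) y :=
    fun y => hcont.integral_hasStrictDerivAt 0 y |>.hasDerivAt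
  set Φ := fun y => ∫ s in (0 : ℝ)..y, F s ^ (m + 1)
  have a1 := P.average_gap hm hΦ hh y
  have a2 := P.average_gap hm hΦ hh (y - h)
  have a3 := P.second_difference hm hΦ hh y
  rw [sub_add_cancel] at a2
  have mono : Monotone Ψ := monotone_of_deriv_nonneg (fun y => (P.hasDerivAt y).differentiableAt)
    fun y => by rw [(P.hasDerivAt y).deriv]; exact P.nonneg y
  have e1 : ∀ d : ℝ, 0 ≤ d → d ^ (m + 1) = h ^ m * (h * (d / h) ^ (m + 1)) := by
    intro d hd
    rw [Real.div_rpow hd hh.le, rpow_add_one_of_nonneg hm hh.le]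
    field_simp
  have e2 : h ^ (m + 2) = h ^ m * h ^ 2 := by
    rw [Real.rpow_add hh, Real.rpow_two]
  rw [e1 _ (sub_nonneg.2 (mono (by linarith))), e1 _ (sub_nonneg.2 (mono (by linarith))), e2]
  have hN : 0 ≤ h ^ m := by positivity
  set v := h * ((Ψ (y + h) - Ψ y) / h) ^ (m + 1)
  set w := h * ((Ψ y - Ψ (y - h)) / h) ^ (m + 1)
  set E := h ^ 2 * h ^ θ
  have key : |(v - w) + 2 * (1 / (m + 2)) * (y * F y) * h ^ 2| ≤
      2 * ((m + 1) * C ^ 2 + 2 * C) * E := by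
    rw [abs_le] at *
    constructor <;> linarith [a1.1, a1.2, a2.1, a2.2, a3.1, a3.2]
  rw [show 1 / 2 * (h ^ m * v - h ^ m * w) + 1 / (m + 2) * (y * F y) * (h ^ m * h ^ 2) =
    h ^ m * (1 / 2 * ((v - w) + 2 * (1 / (m + 2)) * (y * F y) * h ^ 2)) by ring,
    abs_mul, abs_of_nonneg hN, abs_mul, abs_of_pos (by norm_num : (0 : ℝ) < 1 / 2),
    show ((m + 1) * C ^ 2 + 2 * C) * (h ^ m * h ^ 2 * h ^ θ) =
      h ^ m * (1 / 2 * (2 * ((m + 1) * C ^ 2 + 2 * C) * E)) by ring]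
  gcongr

lemma abs_mul_le (P : IsProfile m θ C r K Ψ F) (y : ℝ) : |y * F y| ≤ r * K := by
  rcases le_total r |y| with h | h
  · rw [P.eq_zero y h]
    have := (P.nonneg 0).trans (P.le 0)
    have := P.radius_pos
    simp
    positivity
  · rw [abs_mul, abs_of_nonneg (P.nonneg y)]
    have := P.nonneg y
    have := P.le y
    have := P.radius_pos
    gcongr

lemma dilation (P : IsProfile m θ C r K Ψ F) {l : ℝ} (hl : 1 / 2 ≤ l) (hl1 : l ≤ 1) (y : ℝ) :
    |y * l * F (y * l) - y * F y| ≤ C * (2 * r) ^ θ * (1 - l) ^ θ := by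
  have hC := P.const_nonneg
  have hr := P.radius_pos
  have hθ := P.exponent_pos
  have hl2 : 0 ≤ 1 - l := by linarith
  rcases le_total (2 * r) |y| with h | h
  · have h1 : r ≤ |y * l| := by
      rw [abs_mul, abs_of_nonneg (by linarith : 0 ≤ l)]
      nlinarith
    rw [P.eq_zero _ h1, P.eq_zero y (by linarith)]
    simp
    positivity
  · refine (P.holder_mul _ _).trans ?_
    rw [mul_assoc, ← Real.mul_rpow (by positivity) hl2]
    gcongr
    rw [show y * l - y = -(y * (1 - l)) by ring, abs_neg, abs_mul, abs_of_nonneg hl2]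
    gcongr

lemma time_difference (P : IsProfile m θ C r K Ψ F) (hm : 0 < m) {t : ℝ} (ht : 1 ≤ t) (x : ℝ) :
    |Ψ (x * (t + 1) ^ (-(1 / (m + 2)))) - Ψ (x * t ^ (-(1 / (m + 2))))
      + 1 / (m + 2) * (x * t ^ (-(1 / (m + 2))) * F (x * t ^ (-(1 / (m + 2))))) * t⁻¹| ≤
      (r * K + C * (2 * r) ^ θ) * (t⁻¹ * t⁻¹ ^ θ) := by
  set α := 1 / (m + 2) with hα
  have hα0 : 0 < α := by positivity
  have hα1 : α ≤ 1 := by rw [hα, div_le_one (by linarith)]; linarith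
  have ht0 : 0 < t := by linarith
  have hd : ∀ s, 0 < s → HasDerivAt (fun s => Ψ (x * s ^ (-α)))
      (-α * (x * s ^ (-α) * F (x * s ^ (-α))) * s⁻¹) s := by
    intro s hs
    convert! (P.hasDerivAt (x * s ^ (-α))).comp s
      ((Real.hasDerivAt_rpow_const (p := -α) (Or.inl hs.ne')).const_mul x) using 1
    rw [Real.rpow_sub_one hs.ne']
    ring
  obtain ⟨ξ, hξ, he⟩ := exists_hasDerivAt_eq_slope (fun s => Ψ (x * s ^ (-α))) _
    (show t < t + 1 by linarith)
    (fun s hs => (hd s (by linarith [hs.1])).continuousAt.continuousWithinAt)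
    (fun s hs => hd s (by linarith [hs.1]))
  rw [add_sub_cancel_left, div_one] at he
  have hξ0 : 0 < ξ := by linarith [hξ.1]
  rw [← he]
  set l := (t / ξ) ^ α with hl
  have hq0 : 0 < t / ξ := by positivity
  have hq1 : t / ξ ≤ 1 := by rw [div_le_one hξ0]; exact hξ.1.le
  have hql : t / ξ ≤ l := Real.self_le_rpow_of_le_one hq0.le hq1 hα1
  have hl1 : l ≤ 1 := Real.rpow_le_one hq0.le hq1 hα0.le
  have hq2 : 1 / 2 ≤ t / ξ := by
    rw [div_le_div_iff₀ (by norm_num) hξ0]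
    linarith [hξ.2]
  have hq3 : 1 - t / ξ ≤ t⁻¹ := by
    rw [show 1 - t / ξ = (ξ - t) / ξ by field_simp, inv_eq_one_div,
      div_le_div_iff₀ hξ0 ht0]
    nlinarith [hξ.1, hξ.2]
  have hy : x * ξ ^ (-α) = x * t ^ (-α) * l := by
    rw [hl, Real.div_rpow ht0.le hξ0.le, Real.rpow_neg hξ0.le, Real.rpow_neg ht0.le]
    have := Real.rpow_pos_of_pos ht0 α
    field_simp
  have d1 := P.dilation (hq2.trans hql) hl1 (x * t ^ (-α))
  have d2 := P.abs_mul_le (x * ξ ^ (-α))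
  rw [← hy] at d1
  set z1 := x * ξ ^ (-α) * F (x * ξ ^ (-α))
  set z0 := x * t ^ (-α) * F (x * t ^ (-α))
  have hC := P.const_nonneg
  have hr := P.radius_pos
  have hθ := P.exponent_pos
  have ht1 : 0 ≤ t⁻¹ := by positivity
  have hti : t⁻¹ ≤ 1 := inv_le_one_of_one_le₀ ht
  have d3 : |z1 - z0| ≤ C * (2 * r) ^ θ * t⁻¹ ^ θ := by
    refine d1.trans ?_
    have : 0 ≤ 1 - l := by linarith
    gcongr
    linarith
  have d4 : |ξ⁻¹ - t⁻¹| ≤ t⁻¹ * t⁻¹ ^ θ := by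
    have : t⁻¹ ≤ t⁻¹ ^ θ := Real.self_le_rpow_of_le_one ht1 hti P.exponent_le_one
    have h1 : ξ⁻¹ ≤ t⁻¹ := inv_anti₀ ht0 hξ.1.le
    rw [abs_of_nonpos (by linarith)]
    have h2 : -(ξ⁻¹ - t⁻¹) = t⁻¹ * (1 - t / ξ) := by field_simp; ring
    rw [h2]
    gcongr
    linarith
  rw [show -α * z1 * ξ⁻¹ + α * z0 * t⁻¹ = -(α * (z1 * (ξ⁻¹ - t⁻¹) + (z1 - z0) * t⁻¹)) by ring,
    abs_neg, abs_mul, abs_of_pos hα0]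
  have d5 : |z1 * (ξ⁻¹ - t⁻¹) + (z1 - z0) * t⁻¹| ≤
      (r * K + C * (2 * r) ^ θ) * (t⁻¹ * t⁻¹ ^ θ) := by
    refine (abs_add_le _ _).trans ?_
    rw [abs_mul z1, abs_mul (z1 - z0), abs_of_nonneg ht1]
    have k1 : |z1| * |ξ⁻¹ - t⁻¹| ≤ r * K * (t⁻¹ * t⁻¹ ^ θ) :=
      mul_le_mul d2 d4 (abs_nonneg _) ((abs_nonneg _).trans d2)
    have k2 : |z1 - z0| * t⁻¹ ≤ C * (2 * r) ^ θ * t⁻¹ ^ θ * t⁻¹ := by gcongr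
    linarith
  exact (mul_le_of_le_one_left (abs_nonneg _) hα1).trans d5

/-- The integrated self-similar solution solves the integrated scheme up to a summable error. -/
lemma truncation_error (P : IsProfile m θ C r K Ψ F) (hm : 0 < m) :
    ∃ C' : ℝ, ∀ t : ℝ, 1 ≤ t → ∀ x : ℝ,
      |Ψ (x * (t + 1) ^ (-(1 / (m + 2)))) - (Ψ (x * t ^ (-(1 / (m + 2))))
        + 1 / 2 * ((Ψ ((x + 1) * t ^ (-(1 / (m + 2)))) - Ψ (x * t ^ (-(1 / (m + 2))))) ^ (m + 1)
          - (Ψ (x * t ^ (-(1 / (m + 2)))) - Ψ ((x - 1) * t ^ (-(1 / (m + 2))))) ^ (m + 1)))| ≤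
      C' * t ^ (-(1 + θ / (m + 2))) := by
  refine ⟨(r * K + C * (2 * r) ^ θ) + ((m + 1) * C ^ 2 + 2 * C), fun t ht x => ?_⟩
  have ht0 : 0 < t := by linarith
  set h := t ^ (-(1 / (m + 2))) with hh
  have hh0 : 0 < h := by positivity
  have h1 := P.time_difference hm ht x
  have h2 := P.flux_difference hm hh0 (x * h)
  rw [← hh] at h1
  have e1 : h ^ (m + 2) = t⁻¹ := by
    rw [hh, ← Real.rpow_mul ht0.le, ← Real.rpow_neg_one]
    congr 1
    field_simp
  have e2 : t⁻¹ * h ^ θ = t ^ (-(1 + θ / (m + 2))) := by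
    rw [hh, ← Real.rpow_mul ht0.le, ← Real.rpow_neg_one, ← Real.rpow_add ht0]
    congr 1
    field_simp
    ring
  have e3 : t⁻¹ ^ θ ≤ h ^ θ := by
    have := P.exponent_pos
    rw [hh, ← Real.rpow_neg_one]
    gcongr
    rw [div_le_one (by linarith)]
    linarith
  rw [e1] at h2
  rw [add_mul x, sub_mul x, one_mul, ← e2]
  have e4 : (r * K + C * (2 * r) ^ θ) * (t⁻¹ * t⁻¹ ^ θ) ≤
      (r * K + C * (2 * r) ^ θ) * (t⁻¹ * h ^ θ) := by
    have hr := P.radius_pos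
    have hC := P.const_nonneg
    have hK := (P.nonneg 0).trans (P.le 0)
    gcongr
  have h3 := h1.trans e4
  rw [abs_le] at *
  constructor <;> linarith [h2.1, h2.2, h3.1, h3.2]

end IsProfile

lemma HasDerivAt.max_zero_rpow {p : ℝ} (hp : 1 < p) (x : ℝ) :
    HasDerivAt (fun x : ℝ => max 0 x ^ p) (p * max 0 x ^ (p - 1)) x := by
  have hr := Real.hasDerivAt_rpow_const (x := x) (p := p) (Or.inr hp.le)
  have h0 : ∀ y : ℝ, y ≤ 0 → max 0 y ^ p = 0 := fun y hy => by
    rw [max_eq_left hy, Real.zero_rpow (by linarith)]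
  have h0' : ∀ y : ℝ, y ≤ 0 → max 0 y ^ (p - 1) = 0 := fun y hy => by
    rw [max_eq_left hy, Real.zero_rpow (by linarith)]
  rcases lt_trichotomy x 0 with hx | rfl | hx
  · rw [h0' x hx.le, mul_zero]
    refine (hasDerivAt_const x 0).congr_of_eventuallyEq ?_
    filter_upwards [Iio_mem_nhds hx] with y hy using h0 y (le_of_lt hy)
  · rw [h0' 0 le_rfl, mul_zero, ← hasDerivWithinAt_univ, ← Set.Iic_union_Ici (a := (0 : ℝ))]
    refine HasDerivWithinAt.union ?_ ?_
    · exact (hasDerivWithinAt_const _ _ 0).congr (fun y hy => h0 y hy) (h0 0 le_rfl)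
    · rw [Real.zero_rpow (by linarith), mul_zero] at hr
      exact hr.hasDerivWithinAt.congr (fun y hy => by rw [max_eq_right hy]) (by simp)
  · rw [max_eq_right hx.le]
    refine hr.congr_of_eventuallyEq ?_
    filter_upwards [Ioi_mem_nhds hx] with y hy
    rw [max_eq_right (le_of_lt hy)]

lemma abs_rpow_sub_rpow_le {s a b : ℝ} (hs : 0 < s) (ha : 0 ≤ a) (ha1 : a ≤ 1) (hb : 0 ≤ b)
    (hb1 : b ≤ 1) : |a ^ s - b ^ s| ≤ max 1 s * |a - b| ^ min 1 s := by
  wlog h : b ≤ a generalizing a b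
  · rw [abs_sub_comm, abs_sub_comm a]
    exact this hb hb1 ha ha1 (le_of_not_ge h)
  have h0 : b ^ s ≤ a ^ s := by gcongr
  rw [abs_of_nonneg (by linarith), abs_of_nonneg (by linarith)]
  rcases le_or_gt s 1 with h1 | h1
  · rw [max_eq_left h1, min_eq_right h1, one_mul]
    have := Real.rpow_add_le_add_rpow (show 0 ≤ a - b by linarith) hb hs.le h1
    rw [sub_add_cancel] at this
    linarith
  · rw [max_eq_right h1.le, min_eq_left h1.le, Real.rpow_one]
    have h2 := add_mul_sub_le_rpow (m := s - 1) (by linarith) hb ha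
    rw [sub_add_cancel] at h2
    have h3 : a ^ (s - 1) ≤ 1 := Real.rpow_le_one ha ha1 (by linarith)
    have h4 : s * a ^ (s - 1) * (a - b) ≤ s * 1 * (a - b) := by
      have : 0 ≤ a - b := by linarith
      gcongr
    linarith

lemma le_max_one_mul_rpow {d D M θ : ℝ} (hd : 0 ≤ d) (hM : d ≤ M) (hD : d ≤ D) (hθ : 0 ≤ θ)
    (hθ1 : θ ≤ 1) : d ≤ max 1 M * D ^ θ := by
  rcases hd.eq_or_lt with rfl | hd
  · positivity
  calc d = d ^ (1 - θ) * d ^ θ := by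
        rw [← Real.rpow_add hd]
        simp
    _ ≤ max 1 M ^ (1 - θ) * D ^ θ := by
        have := hM.trans (le_max_right 1 M)
        gcongr
    _ ≤ max 1 M * D ^ θ := by
        have := hd.le.trans hD
        gcongr
        exact Real.rpow_le_self_of_one_le (le_max_left _ _) (by linarith)

lemma betaFn_pos {a b : ℝ} (ha : 0 < a) (hb : 0 < b) : 0 < betaFn a b := by
  unfold betaFn
  have := Real.Gamma_pos_of_pos ha
  have := Real.Gamma_pos_of_pos hb
  have := Real.Gamma_pos_of_pos (add_pos ha hb)
  positivity

lemma betaFn_self {a : ℝ} (ha : 0 < a) : betaFn a a = 2 ^ (1 - 2 * a) * betaFn (1 / 2) a := by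
  have h := Real.Gamma_mul_Gamma_add_half a
  have h1 := Real.Gamma_pos_of_pos (show 0 < a + 1 / 2 by linarith)
  have h2 := Real.Gamma_pos_of_pos (show 0 < 2 * a by linarith)
  unfold betaFn
  rw [Real.Gamma_one_half_eq, add_comm (1 / 2) a, ← two_mul, mul_div_assoc', div_eq_div_iff h2.ne'
    h1.ne']
  linear_combination Real.Gamma a * h

lemma rhoC_pos {m : ℝ} (hm : 0 < m) : 0 < rhoC m := by
  unfold rhoC
  positivity

lemma DC_pos {m : ℝ} (hm : 0 < m) : 0 < DC m := by
  have := rhoC_pos hm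
  have := betaFn_pos (show (0 : ℝ) < 1 / 2 by norm_num) (show 0 < (m + 1) / m by positivity)
  unfold DC
  positivity

lemma cC_pos {m : ℝ} (hm : 0 < m) : 0 < cC m := by
  have := rhoC_pos hm
  have := DC_pos hm
  unfold cC
  positivity

lemma cC_rpow_mul_betaFn_rpow {m : ℝ} (hm : 0 < m) :
    cC m ^ (m + 2) * betaFn ((m + 1) / m) ((m + 1) / m) ^ m = (m + 1) * (m + 2) / m := by
  have hρ := rhoC_pos hm
  have hD := DC_pos hm
  have hb := betaFn_pos (show (0 : ℝ) < 1 / 2 by norm_num) (show 0 < (m + 1) / m by positivity)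
  have hDm : DC m ^ m * rhoC m ^ (m / 2) = betaFn (1 / 2) ((m + 1) / m) ^ m := by
    unfold DC
    rw [Real.mul_rpow (by positivity) hb.le, ← Real.rpow_mul hρ.le, mul_right_comm,
      ← Real.rpow_add hρ]
    ring_nf
    simp
  have hc : cC m ^ (m + 2) * (DC m ^ m * rhoC m ^ ((m + 2) / 2)) = 2 ^ (m + 1) * (m + 1) := by
    unfold cC
    rw [Real.div_rpow (by positivity) (by positivity), Real.mul_rpow (by positivity) (by positivity),
      Real.mul_rpow (by positivity) (by positivity), ← Real.rpow_mul (by positivity),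
      ← Real.rpow_mul (by positivity), ← Real.rpow_mul (by positivity),
      ← Real.rpow_mul (by positivity), div_mul_cancel₀ _ (by positivity),
      div_mul_cancel₀ _ (by positivity), div_mul_cancel₀ _ (by positivity), Real.rpow_one,
      show (1 : ℝ) / 2 * (m + 2) = (m + 2) / 2 by ring, div_mul_cancel₀ _ (by positivity)]
  have hB : betaFn ((m + 1) / m) ((m + 1) / m) ^ m * 2 ^ (m + 2) =
      betaFn (1 / 2) ((m + 1) / m) ^ m := by
    rw [betaFn_self (by positivity), Real.mul_rpow (by positivity) hb.le,
      ← Real.rpow_mul (by positivity), mul_right_comm, ← Real.rpow_add (by positivity),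
      show (1 - 2 * ((m + 1) / m)) * m + (m + 2) = 0 by field_simp; ring, Real.rpow_zero, one_mul]
  rw [show (m + 2) / 2 = m / 2 + 1 by ring, Real.rpow_add_one hρ.ne', ← mul_assoc (DC m ^ m), hDm,
    ← hB] at hc
  rw [show m + 2 = m + 1 + 1 by ring, Real.rpow_add_one (by norm_num : (2 : ℝ) ≠ 0),
    show m + 1 + 1 = m + 2 by ring] at hc
  have h2 : (0 : ℝ) < 2 ^ (m + 1) := by positivity
  have h3 : cC m ^ (m + 2) * betaFn ((m + 1) / m) ((m + 1) / m) ^ m * (2 * rhoC m) = m + 1 := by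
    apply mul_left_cancel₀ h2.ne'
    linear_combination hc
  unfold rhoC at h3
  field_simp at h3 ⊢
  linear_combination h3

lemma integral_rpow_mul_rpow {a : ℝ} (ha : 0 < a) :
    ∫ y in (0 : ℝ)..1, y ^ (a - 1) * (1 - y) ^ (a - 1) = betaFn a a := by
  have h := ProbabilityTheory.beta_eq_betaIntegralReal a a ha ha
  unfold ProbabilityTheory.beta at h
  unfold betaFn
  rw [h, Complex.betaIntegral]
  have : ∫ y in (0 : ℝ)..1, (y : ℂ) ^ ((a : ℂ) - 1) * (1 - (y : ℂ)) ^ ((a : ℂ) - 1) =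
      ∫ y in (0 : ℝ)..1, ((y ^ (a - 1) * (1 - y) ^ (a - 1) : ℝ) : ℂ) := by
    refine intervalIntegral.integral_congr fun y hy => ?_
    rw [Set.uIcc_of_le zero_le_one] at hy
    rw [Complex.ofReal_mul, Complex.ofReal_cpow hy.1, Complex.ofReal_cpow (by linarith [hy.2])]
    push_cast
    rfl
  rw [this, intervalIntegral.integral_ofReal, Complex.ofReal_re]

/-- The density of the limit law. -/
noncomputable def limitPDF (m x : ℝ) : ℝ :=
  1 / (betaFn ((m + 1) / m) ((m + 1) / m) * cC m) * max 0 (1 / 4 - (x / cC m) ^ 2) ^ (1 / m)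

lemma limitCDF_eq {m : ℝ} (hm : 0 < m) (x : ℝ) :
    limitCDF m x = 1 / betaFn ((m + 1) / m) ((m + 1) / m) *
      ∫ y in (0 : ℝ)..(1 / 2 + x / cC m), max 0 (y * (1 - y)) ^ (1 / m) := by
  unfold limitCDF
  congr 1
  set t := 1 / 2 + x / cC m
  have hs : 1 / m ≠ 0 := by positivity
  have hcont : Continuous fun y : ℝ => max 0 (y * (1 - y)) ^ (1 / m) :=
    Continuous.rpow_const (by fun_prop) fun _ => Or.inr (by positivity)
  have hin : ∀ s ∈ Set.Icc (0 : ℝ) 1, ∫ y in (0 : ℝ)..s, y ^ (1 / m) * (1 - y) ^ (1 / m) =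
      ∫ y in (0 : ℝ)..s, max 0 (y * (1 - y)) ^ (1 / m) := by
    intro s hs
    refine intervalIntegral.integral_congr fun y hy => ?_
    rw [Set.uIcc_of_le hs.1] at hy
    have h1 : 0 ≤ y := hy.1
    have h2 : 0 ≤ 1 - y := by linarith [hy.2, hs.2]
    simp only [max_eq_right (mul_nonneg h1 h2), Real.mul_rpow h1 h2]
  have hout : ∀ a b : ℝ, (∀ y ∈ Set.uIcc a b, y * (1 - y) ≤ 0) →
      ∫ y in a..b, max 0 (y * (1 - y)) ^ (1 / m) = 0 := by
    intro a b h
    refine (intervalIntegral.integral_congr (g := fun _ => 0) fun y hy => ?_).trans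
      intervalIntegral.integral_zero
    simp only [max_eq_left (h y hy), Real.zero_rpow hs]
  rcases lt_or_ge t 0 with h0 | h0
  · rw [max_eq_right h0.le, min_eq_left zero_le_one, intervalIntegral.integral_same, hout]
    intro y hy
    rw [Set.uIcc_of_ge h0.le] at hy
    nlinarith [hy.2]
  rw [max_eq_left h0]
  rcases le_or_gt t 1 with h1 | h1
  · rw [min_eq_left h1, hin t ⟨h0, h1⟩]
  · rw [min_eq_right h1.le, hin 1 ⟨zero_le_one, le_rfl⟩,
      ← intervalIntegral.integral_add_adjacent_intervals (hcont.intervalIntegrable 0 1)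
        (hcont.intervalIntegrable 1 t), hout 1 t, add_zero]
    intro y hy
    rw [Set.uIcc_of_le h1.le] at hy
    nlinarith [hy.1]

lemma hasDerivAt_limitCDF {m : ℝ} (hm : 0 < m) (x : ℝ) :
    HasDerivAt (limitCDF m) (limitPDF m x) x := by
  have hcont : Continuous fun y : ℝ => max 0 (y * (1 - y)) ^ (1 / m) :=
    Continuous.rpow_const (by fun_prop) fun _ => Or.inr (by positivity)
  rw [funext (limitCDF_eq hm)]
  have h1 := (hcont.integral_hasStrictDerivAt 0 (1 / 2 + x / cC m)).hasDerivAt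
  convert! (h1.comp x (((hasDerivAt_id' x).div_const (cC m)).const_add (1 / 2))).const_mul
    (1 / betaFn ((m + 1) / m) ((m + 1) / m)) using 1
  unfold limitPDF
  rw [show (1 / 2 + x / cC m) * (1 - (1 / 2 + x / cC m)) = 1 / 4 - (x / cC m) ^ 2 by ring]
  have := cC_pos hm
  have := betaFn_pos (show 0 < (m + 1) / m by positivity) (show 0 < (m + 1) / m by positivity)
  field_simp

lemma limitCDF_of_le {m x : ℝ} (hm : 0 < m) (hx : x ≤ -(cC m / 2)) : limitCDF m x = 0 := by
  have hc := cC_pos hm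
  have : 1 / 2 + x / cC m ≤ 0 := by
    have : x / cC m ≤ -(1 / 2) := by
      rw [div_le_iff₀ hc]
      linarith
    linarith
  unfold limitCDF
  rw [max_eq_right this, min_eq_left zero_le_one, intervalIntegral.integral_same, mul_zero]

lemma limitCDF_of_ge {m x : ℝ} (hm : 0 < m) (hx : cC m / 2 ≤ x) : limitCDF m x = 1 := by
  have hc := cC_pos hm
  have ha : 0 < (m + 1) / m := by positivity
  have : 1 ≤ 1 / 2 + x / cC m := by
    have : 1 / 2 ≤ x / cC m := by
      rw [le_div_iff₀ hc]
      linarith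
    linarith
  unfold limitCDF
  have h := integral_rpow_mul_rpow ha
  rw [show (m + 1) / m - 1 = 1 / m by field_simp; ring] at h
  rw [min_eq_right (this.trans (le_max_left _ _)), h, one_div_mul_cancel (betaFn_pos ha ha).ne']

lemma limitPDF_nonneg {m : ℝ} (hm : 0 < m) (x : ℝ) : 0 ≤ limitPDF m x := by
  have hc := cC_pos hm
  have ha : 0 < (m + 1) / m := by positivity
  have := betaFn_pos ha ha
  unfold limitPDF
  positivity

lemma limitCDF_monotone {m : ℝ} (hm : 0 < m) : Monotone (limitCDF m) :=
  monotone_of_deriv_nonneg (fun x => (hasDerivAt_limitCDF hm x).differentiableAt)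
    fun x => (hasDerivAt_limitCDF hm x).deriv ▸ limitPDF_nonneg hm x

lemma abs_clamp_sub_clamp_le (c x y : ℝ) :
    |max (-c) (min x c) - max (-c) (min y c)| ≤ |x - y| :=
  (abs_max_sub_max_le_max _ _ _ _).trans (max_le (by simp)
    ((abs_min_sub_min_le_max _ _ _ _).trans (by simp)))

lemma abs_clamp_le {c : ℝ} (hc : 0 ≤ c) (x : ℝ) : |max (-c) (min x c)| ≤ c :=
  abs_le.2 ⟨le_max_left _ _, max_le (by linarith) (min_le_right _ _)⟩

lemma max_zero_quarter_sub_sq {c : ℝ} (hc : 0 < c) (x : ℝ) :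
    max 0 (1 / 4 - (x / c) ^ 2) = 1 / 4 - (max (-(c / 2)) (min x (c / 2)) / c) ^ 2 := by
  have h : 1 / 4 - (x / c) ^ 2 = (c / 2 - x) * (c / 2 + x) / c ^ 2 := by
    field_simp
    ring
  rcases le_total x (-(c / 2)) with h1 | h1
  · rw [min_eq_left (by linarith), max_eq_left h1, max_eq_left, neg_div, neg_sq]
    · field_simp
      norm_num
    · rw [h]
      exact div_nonpos_of_nonpos_of_nonneg
        (mul_nonpos_of_nonneg_of_nonpos (by linarith) (by linarith)) (by positivity)
  rcases le_total x (c / 2) with h2 | h2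
  · rw [min_eq_left h2, max_eq_right h1, max_eq_right]
    rw [h]
    exact div_nonneg (mul_nonneg (by linarith) (by linarith)) (by positivity)
  · rw [min_eq_right h2, max_eq_right (show -(c / 2) ≤ c / 2 by linarith), max_eq_left]
    · field_simp
      norm_num
    · rw [h]
      exact div_nonpos_of_nonpos_of_nonneg
        (mul_nonpos_of_nonpos_of_nonneg (by linarith) (by linarith)) (by positivity)

lemma abs_max_zero_sub_le {c : ℝ} (hc : 0 < c) (x y : ℝ) :
    |max 0 (1 / 4 - (x / c) ^ 2) - max 0 (1 / 4 - (y / c) ^ 2)| ≤ |x - y| / c := by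
  rw [max_zero_quarter_sub_sq hc, max_zero_quarter_sub_sq hc]
  have h1 := abs_clamp_sub_clamp_le (c / 2) x y
  have h2 := abs_clamp_le (show 0 ≤ c / 2 by positivity) x
  have h3 := abs_clamp_le (show 0 ≤ c / 2 by positivity) y
  set a := max (-(c / 2)) (min x (c / 2))
  set b := max (-(c / 2)) (min y (c / 2))
  have h4 : |a + b| ≤ c := (abs_add_le _ _).trans (by linarith)
  rw [show 1 / 4 - (a / c) ^ 2 - (1 / 4 - (b / c) ^ 2) = -((a - b) * (a + b) / c ^ 2) by ring,
    abs_neg, abs_div, abs_mul, abs_of_pos (show 0 < c ^ 2 by positivity)]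
  calc |a - b| * |a + b| / c ^ 2 ≤ |x - y| * c / c ^ 2 := by gcongr
    _ = |x - y| / c := by field_simp

lemma isProfile_limitCDF {m : ℝ} (hm : 0 < m) :
    ∃ C r K : ℝ, IsProfile m (min 1 (1 / m)) C r K (limitCDF m) (limitPDF m) := by
  have hc := cC_pos hm
  have ha : 0 < (m + 1) / m := by positivity
  have hB := betaFn_pos ha ha
  have hs : 0 < 1 / m := by positivity
  have hrel := cC_rpow_mul_betaFn_rpow hm
  set c := cC m
  set B := betaFn ((m + 1) / m) ((m + 1) / m)
  set A := 1 / (B * c) with hA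
  set w : ℝ → ℝ := fun x => max 0 (1 / 4 - (x / c) ^ 2) with hw
  have hF : ∀ x, limitPDF m x = A * w x ^ (1 / m) := fun x => rfl
  have hA0 : 0 < A := by positivity
  have hw0 : ∀ x, 0 ≤ w x := fun x => le_max_left _ _
  have hw1 : ∀ x, w x ≤ 1 := fun x => max_le zero_le_one (by nlinarith [sq_nonneg (x / c)])
  have hFK : ∀ x, limitPDF m x ≤ A := fun x => by
    rw [hF]
    exact mul_le_of_le_one_right hA0.le (Real.rpow_le_one (hw0 x) (hw1 x) hs.le)
  have hwr : ∀ y, c / 2 ≤ |y| → w y = 0 := fun y hy => by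
    refine max_eq_left ?_
    have : 1 / 2 ≤ |y / c| := by
      rw [abs_div, abs_of_pos hc, le_div_iff₀ hc]
      linarith
    nlinarith [sq_abs (y / c)]
  have hFr : ∀ y, c / 2 ≤ |y| → limitPDF m y = 0 := fun y hy => by
    rw [hF, hwr y hy, Real.zero_rpow hs.ne', mul_zero]
  have hθ0 : 0 < min 1 (1 / m) := lt_min one_pos hs
  have hθ1 : min 1 (1 / m) ≤ 1 := min_le_left _ _
  set θ := min 1 (1 / m)
  set C₁ := A * max 1 (1 / m) * (1 / c) ^ θ with hC₁
  have hC₁0 : 0 ≤ C₁ := by positivity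
  have hh : ∀ x y, |limitPDF m x - limitPDF m y| ≤ C₁ * |x - y| ^ θ := fun x y => by
    rw [hF, hF, ← mul_sub, abs_mul, abs_of_pos hA0, hC₁, mul_assoc, mul_assoc]
    gcongr
    refine (abs_rpow_sub_rpow_le hs (hw0 x) (hw1 x) (hw0 y) (hw1 y)).trans ?_
    gcongr
    rw [← Real.mul_rpow (by positivity) (abs_nonneg _)]
    have := abs_max_zero_sub_le hc x y
    rw [div_eq_inv_mul |x - y|, ← one_div c] at this
    gcongr
  have hclamp : ∀ y, y * limitPDF m y = max (-(c / 2)) (min y (c / 2)) * limitPDF m y := by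
    intro y
    rcases le_or_gt (c / 2) |y| with h | h
    · rw [hFr y h, mul_zero, mul_zero]
    · rw [abs_lt] at h
      rw [min_eq_left h.2.le, max_eq_right h.1.le]
  have hFm : ∀ y, limitPDF m y ^ m = A ^ m * w y := fun y => by
    rw [hF, Real.mul_rpow hA0.le (Real.rpow_nonneg (hw0 y) _), ← Real.rpow_mul (hw0 y),
      one_div_mul_cancel hm.ne', Real.rpow_one]
  refine ⟨C₁ + (c / 2 * C₁ + A * max 1 c) + A ^ m / c, c / 2, A, fun y => hasDerivAt_limitCDF hm y,
    limitPDF_nonneg hm, hFK, fun y => ?_, fun x y => ?_, fun x y => ?_, fun x y => ?_, hFr,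
    by positivity, by positivity, hθ0, hθ1⟩
  · have hfun : (fun y => limitPDF m y ^ (m + 1)) = fun y => A ^ (m + 1) * w y ^ (1 + 1 / m) := by
      funext y
      rw [hF, Real.mul_rpow hA0.le (Real.rpow_nonneg (hw0 y) _), ← Real.rpow_mul (hw0 y)]
      congr 2
      field_simp
    have hd : HasDerivAt (fun y => 1 / 4 - (y / c) ^ 2) (-(2 * (y / c) * (1 / c))) y := by
      convert! (((hasDerivAt_id' y).div_const c).pow 2).const_sub (1 / 4) using 1
      simp
    have hcoef : A ^ m * ((m + 1) / (m * c ^ 2)) = 1 / (m + 2) := by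
      have h1 : c ^ (m + 2) = c ^ m * c ^ 2 := by
        rw [Real.rpow_add hc, Real.rpow_two]
      have h2 : 0 < c ^ m := by positivity
      have h3 : 0 < B ^ m := by positivity
      rw [hA, Real.div_rpow zero_le_one (by positivity), Real.one_rpow, Real.mul_rpow hB.le hc.le]
      rw [h1] at hrel
      field_simp at hrel ⊢
      linear_combination -hrel
    rw [hfun, hF]
    convert! ((HasDerivAt.max_zero_rpow (show 1 < 1 + 1 / m by linarith)
      (1 / 4 - (y / c) ^ 2)).comp y hd).const_mul (A ^ (m + 1)) using 1
    rw [add_sub_cancel_left, Real.rpow_add_one hA0.ne', ← hcoef]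
    simp only [hw]
    field_simp
  · refine (hh x y).trans ?_
    gcongr
    have : 0 ≤ c / 2 * C₁ + A * max 1 c + A ^ m / c := by positivity
    linarith
  · rw [hclamp, hclamp]
    have h1 := abs_clamp_sub_clamp_le (c / 2) x y
    have h2 := abs_clamp_le (show 0 ≤ c / 2 by positivity) x
    have h3 := abs_clamp_le (show 0 ≤ c / 2 by positivity) y
    set a := max (-(c / 2)) (min x (c / 2))
    set b := max (-(c / 2)) (min y (c / 2))
    have h4 : |a - b| ≤ c := (abs_sub _ _).trans (by linarith)
    have h5 := le_max_one_mul_rpow (abs_nonneg (a - b)) h4 h1 hθ0.le hθ1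
    have h6 : |limitPDF m y| ≤ A := by
      rw [abs_of_nonneg (limitPDF_nonneg hm y)]
      exact hFK y
    calc |a * limitPDF m x - b * limitPDF m y|
        = |a * (limitPDF m x - limitPDF m y) + limitPDF m y * (a - b)| := by ring_nf
      _ ≤ |a| * |limitPDF m x - limitPDF m y| + |limitPDF m y| * |a - b| := by
        rw [← abs_mul, ← abs_mul]
        exact abs_add_le _ _
      _ ≤ c / 2 * (C₁ * |x - y| ^ θ) + A * (max 1 c * |x - y| ^ θ) := by
        gcongr
        exact hh x y
      _ = (c / 2 * C₁ + A * max 1 c) * |x - y| ^ θ := by ring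
      _ ≤ _ := by
        have : 0 ≤ A ^ m / c := by positivity
        refine mul_le_mul_of_nonneg_right ?_ (by positivity)
        linarith
  · rw [hFm, hFm, ← mul_sub, abs_mul, abs_of_pos (show 0 < A ^ m by positivity)]
    have h1 := abs_max_zero_sub_le hc x y
    calc A ^ m * |w x - w y| ≤ A ^ m * (|x - y| / c) := by gcongr
      _ = A ^ m / c * |x - y| := by ring
      _ ≤ _ := by
        gcongr
        have : 0 ≤ c / 2 * C₁ + A * max 1 c := by positivity
        linarith

lemma IsProfile.sub_le {m θ C r K : ℝ} {Ψ F : ℝ → ℝ} (P : IsProfile m θ C r K Ψ F) {h : ℝ}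
    (hh : 0 ≤ h) (y : ℝ) : Ψ (y + h) - Ψ y ≤ K * h :=
  (le_abs_self _).trans <| abs_sub_le_of_hasDerivAt hh P.hasDerivAt fun s _ => by
    rw [abs_of_nonneg (P.nonneg s)]
    exact P.le s

/-- The integrated solution of the scheme stays between two translates of the integrated
self-similar solution, started at a large time `τ`. -/
lemma IsScheme.exists_sandwich {m : ℝ} {p : ℕ → ℤ → ℝ} (hrec : IsScheme m p) (hm : 0 < m)
    (h0 : ∀ k, 0 ≤ p 0 k) (hs : HasSum (p 0) 1) {ε : ℝ} (hε : 0 < ε) :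
    ∃ (N τ : ℕ) (L : ℝ), ∀ (n : ℕ) (k : ℤ),
      cdfSum (p (n + N)) k ≤ limitCDF m ((k + L) * ((n + τ : ℕ) : ℝ) ^ (-(1 / (m + 2)))) + ε ∧
      limitCDF m ((k + -L) * ((n + τ : ℕ) : ℝ) ^ (-(1 / (m + 2)))) ≤ cdfSum (p (n + N)) k + ε := by
  obtain ⟨C, r, K, P⟩ := isProfile_limitCDF hm
  obtain ⟨C', htr⟩ := P.truncation_error hm
  have hθ := P.exponent_pos
  have hmono := limitCDF_monotone hm
  set Ψ := limitCDF m
  set θ := min 1 (1 / m)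
  set u : ℝ := (m + 1) ^ (-(1 / m)) with hu
  have hu0 : 0 < u := by positivity
  have hum : (m + 1) * u ^ m = 1 := by
    rw [hu, ← Real.rpow_mul (by positivity), neg_mul, one_div_mul_cancel hm.ne', Real.rpow_neg_one,
      mul_inv_cancel₀ (by positivity)]
  have hu1 : u ≤ 1 := Real.rpow_le_one_of_one_le_of_nonpos (by linarith)
    (neg_nonpos.2 (by positivity))
  obtain ⟨N, hN⟩ := hrec.eventually_le hm h0 hs hu0.le hu1 hum.ge
  have hp := fun n => hrec.nonneg_and_hasSum hm h0 hs n
  have hα : 0 < 1 / (m + 2) := by positivity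
  set α := 1 / (m + 2)
  set f : ℕ → ℝ := fun j => |C'| * (j : ℝ) ^ (-(1 + θ / (m + 2))) with hf
  have hfs : Summable f := by
    refine (Real.summable_nat_rpow.2 ?_).mul_left _
    have : 0 < θ / (m + 2) := by positivity
    linarith
  have hf0 : ∀ j, 0 ≤ f j := fun j => by positivity
  have hlim : Tendsto (fun n : ℕ => K * (n : ℝ) ^ (-α)) atTop (nhds 0) := by
    simpa using ((tendsto_rpow_neg_atTop hα).comp tendsto_natCast_atTop_atTop).const_mul K
  obtain ⟨τ, hτu, hτe, hτ1⟩ := ((hlim.eventually_le_const hu0).and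
    (((tendsto_sum_nat_add f).eventually_le_const (half_pos hε)).and
      (eventually_ge_atTop 1))).exists
  have hK : 0 ≤ K := (P.nonneg 0).trans (P.le 0)
  have hsum : ∀ n, ∑ j ∈ Finset.range n, f (j + τ) ≤ ε / 2 := fun n =>
    (((summable_nat_add_iff τ).2 hfs).sum_le_tsum _ fun j _ => hf0 _).trans hτe
  obtain ⟨M₁, hM₁⟩ := ((tendsto_cdfSum_atBot (hp N).2.summable).eventually_le_const
    (half_pos hε)).exists_forall_of_atBot
  obtain ⟨M₂, hM₂⟩ := ((tendsto_cdfSum_atTop (hp N).2).eventually_const_le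
    (show 1 - ε / 2 < 1 by linarith)).exists_forall_of_atTop
  have hτ0 : (0 : ℝ) < τ := by exact_mod_cast hτ1
  set M : ℝ := max (-M₁) M₂ with hM
  set L : ℝ := M + cC m / 2 * (τ : ℝ) ^ α with hL
  have hpos : ∀ n : ℕ, (1 : ℝ) ≤ ((n + τ : ℕ) : ℝ) := fun n => by
    exact_mod_cast hτ1.trans (Nat.le_add_left _ _)
  have hQ0 : ∀ (l : ℝ) (n : ℕ) (k : ℤ), 0 ≤ Ψ (((k + 1 : ℤ) + l) * ((n + τ : ℕ) : ℝ) ^ (-α)) -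
      Ψ ((k + l) * ((n + τ : ℕ) : ℝ) ^ (-α)) := by
    intro l n k
    refine sub_nonneg.2 (hmono ?_)
    gcongr
    linarith
  have hQu : ∀ (l : ℝ) (n : ℕ) (k : ℤ), Ψ (((k + 1 : ℤ) + l) * ((n + τ : ℕ) : ℝ) ^ (-α)) -
      Ψ ((k + l) * ((n + τ : ℕ) : ℝ) ^ (-α)) ≤ u := by
    intro l n k
    have hle : ((n + τ : ℕ) : ℝ) ^ (-α) ≤ (τ : ℝ) ^ (-α) :=
      Real.rpow_le_rpow_of_nonpos hτ0 (by push_cast; linarith [n.cast_nonneg (α := ℝ)])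
        (by linarith)
    rw [show ((k + 1 : ℤ) + l) * ((n + τ : ℕ) : ℝ) ^ (-α) =
      (k + l) * ((n + τ : ℕ) : ℝ) ^ (-α) + ((n + τ : ℕ) : ℝ) ^ (-α) by push_cast; ring]
    exact (P.sub_le (by positivity) _).trans ((mul_le_mul_of_nonneg_left hle hK).trans hτu)
  have hQs : ∀ (l : ℝ) (n : ℕ) (k : ℤ), |Ψ ((k + l) * ((n + 1 + τ : ℕ) : ℝ) ^ (-α)) -
      (Ψ ((k + l) * ((n + τ : ℕ) : ℝ) ^ (-α)) +
        1 / 2 * ((Ψ (((k + 1 : ℤ) + l) * ((n + τ : ℕ) : ℝ) ^ (-α)) -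
          Ψ ((k + l) * ((n + τ : ℕ) : ℝ) ^ (-α))) ^ (m + 1) -
        (Ψ ((k + l) * ((n + τ : ℕ) : ℝ) ^ (-α)) -
          Ψ (((k - 1 : ℤ) + l) * ((n + τ : ℕ) : ℝ) ^ (-α))) ^ (m + 1)))| ≤ f (n + τ) := by
    intro l n k
    have h := htr ((n + τ : ℕ) : ℝ) (hpos n) (k + l)
    rw [show (k : ℝ) + l + 1 = (k + 1 : ℤ) + l by push_cast; ring,
      show (k : ℝ) + l - 1 = (k - 1 : ℤ) + l by push_cast; ring,
      show ((n + τ : ℕ) : ℝ) + 1 = (n + 1 + τ : ℕ) by push_cast; ring] at h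
    refine h.trans ?_
    simp only [hf]
    gcongr
    exact le_abs_self _
  have hinc : ∀ (n : ℕ) (k : ℤ), cdfSum (p n) (k + 1) - cdfSum (p n) k = p n (k + 1) := by
    intro n k
    rw [cdfSum_add_one (hp n).2.summable, add_sub_cancel_left]
  have hA0 : ∀ (n : ℕ) (k : ℤ), 0 ≤ cdfSum (p (n + N)) (k + 1) - cdfSum (p (n + N)) k := by
    intro n k
    rw [hinc]
    exact (hp _).1 _
  have hAu : ∀ (n : ℕ) (k : ℤ), cdfSum (p (n + N)) (k + 1) - cdfSum (p (n + N)) k ≤ u := by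
    intro n k
    rw [hinc]
    exact hN _ (Nat.le_add_left _ _) _
  have hAs : ∀ (n : ℕ) (k : ℤ), cdfSum (p (n + 1 + N)) k - (cdfSum (p (n + N)) k +
      1 / 2 * ((cdfSum (p (n + N)) (k + 1) - cdfSum (p (n + N)) k) ^ (m + 1) -
        (cdfSum (p (n + N)) k - cdfSum (p (n + N)) (k - 1)) ^ (m + 1))) = 0 := by
    intro n k
    have h := hinc (n + N) (k - 1)
    rw [sub_add_cancel] at h
    rw [hinc, h, Nat.add_right_comm, hrec.cdfSum_succ hm h0 hs, sub_self]
  have hτα : (τ : ℝ) ^ α * (τ : ℝ) ^ (-α) = 1 := by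
    rw [← Real.rpow_add hτ0, add_neg_cancel, Real.rpow_zero]
  have hcτ : 0 < (τ : ℝ) ^ (-α) := by positivity
  have hup : ∀ k : ℤ, cdfSum (p N) k ≤ Ψ ((k + L) * (τ : ℝ) ^ (-α)) + ε / 2 := by
    intro k
    rcases le_total k M₁ with h | h
    · have : 0 ≤ Ψ ((k + L) * (τ : ℝ) ^ (-α)) := by
        rw [← limitCDF_of_le hm (min_le_left (-(cC m / 2)) ((k + L) * (τ : ℝ) ^ (-α)))]
        exact hmono (min_le_right _ _)
      linarith [hM₁ k h]
    · have hk : (M₁ : ℝ) ≤ k := by exact_mod_cast h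
      have hM' : -(M₁ : ℝ) ≤ M := le_max_left _ _
      have : cC m / 2 ≤ (k + L) * (τ : ℝ) ^ (-α) := by
        calc cC m / 2 = cC m / 2 * (τ : ℝ) ^ α * (τ : ℝ) ^ (-α) := by rw [mul_assoc, hτα, mul_one]
          _ ≤ _ := by
            gcongr
            linarith
      rw [show Ψ ((k + L) * (τ : ℝ) ^ (-α)) = 1 from limitCDF_of_ge hm this]
      linarith [cdfSum_le (hp N).1 (hp N).2 k]
  have hlow : ∀ k : ℤ, Ψ ((k + -L) * (τ : ℝ) ^ (-α)) ≤ cdfSum (p N) k + ε / 2 := by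
    intro k
    rcases le_total M₂ k with h | h
    · have : Ψ ((k + -L) * (τ : ℝ) ^ (-α)) ≤ 1 := by
        rw [← limitCDF_of_ge hm (le_max_left (cC m / 2) ((k + -L) * (τ : ℝ) ^ (-α)))]
        exact hmono (le_max_right _ _)
      linarith [hM₂ k h]
    · have hk : (k : ℝ) ≤ M₂ := by exact_mod_cast h
      have hM' : (M₂ : ℝ) ≤ M := le_max_right _ _
      have : (k + -L) * (τ : ℝ) ^ (-α) ≤ -(cC m / 2) := by
        calc (k + -L) * (τ : ℝ) ^ (-α) ≤ -(cC m / 2 * (τ : ℝ) ^ α) * (τ : ℝ) ^ (-α) := by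
              gcongr
              linarith
          _ = -(cC m / 2) := by rw [neg_mul, mul_assoc, hτα, mul_one]
      rw [show Ψ ((k + -L) * (τ : ℝ) ^ (-α)) = 0 from limitCDF_of_le hm this]
      linarith [cdfSum_nonneg (hp N).1 k]
  refine ⟨N, τ, L, fun n k => ⟨?_, ?_⟩⟩
  · have := scheme_comparison hm hum.le (A := fun n k => cdfSum (p (n + N)) k)
      (B := fun n k => Ψ ((k + L) * ((n + τ : ℕ) : ℝ) ^ (-α))) (e := fun j => f (j + τ)) hA0 hAu
      (hQ0 L) (hQu L) (fun n k => by linarith [hAs n k, (abs_le.1 (hQs L n k)).1])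
      (fun k => by simpa using hup k) n k
    linarith [hsum n]
  · have := scheme_comparison hm hum.le (B := fun n k => cdfSum (p (n + N)) k)
      (A := fun n k => Ψ ((k + -L) * ((n + τ : ℕ) : ℝ) ^ (-α))) (e := fun j => f (j + τ))
      (hQ0 (-L)) (hQu (-L)) hA0 hAu
      (fun n k => by linarith [hAs n k, (abs_le.1 (hQs (-L) n k)).2])
      (fun k => by simpa using hlow k) n k
    linarith [hsum n]

lemma tendsto_floor_add_mul_rpow {α : ℝ} (hα : 0 < α) (x l : ℝ) (N τ : ℕ) :
    Tendsto (fun n : ℕ => (⌊x * ((n + N : ℕ) : ℝ) ^ α⌋ + l) * ((n + τ : ℕ) : ℝ) ^ (-α)) atTop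
      (nhds x) := by
  have hτ : Tendsto (fun n : ℕ => ((n + τ : ℕ) : ℝ)) atTop atTop :=
    tendsto_natCast_atTop_atTop.comp (tendsto_add_atTop_nat τ)
  have hrat : Tendsto (fun n : ℕ => ((n + N : ℕ) : ℝ) / ((n + τ : ℕ) : ℝ)) atTop (nhds 1) := by
    have h := (hτ.const_div_atTop ((N : ℝ) - τ)).const_add 1
    rw [add_zero] at h
    refine h.congr' ?_
    filter_upwards [eventually_gt_atTop 0] with n hn
    have : (0 : ℝ) < ((n + τ : ℕ) : ℝ) := by positivity
    field_simp
    push_cast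
    ring
  have h1 := (hrat.rpow_const (p := α) (Or.inr hα.le)).const_mul x
  rw [Real.one_rpow, mul_one] at h1
  have h2 : Tendsto (fun n : ℕ => ((n + τ : ℕ) : ℝ) ^ (-α)) atTop (nhds 0) :=
    (tendsto_rpow_neg_atTop hα).comp hτ
  have h3 : Tendsto (fun n : ℕ => (⌊x * ((n + N : ℕ) : ℝ) ^ α⌋ - x * ((n + N : ℕ) : ℝ) ^ α + l) *
      ((n + τ : ℕ) : ℝ) ^ (-α)) atTop (nhds 0) := by
    refine squeeze_zero_norm (a := fun n : ℕ => (1 + |l|) * ((n + τ : ℕ) : ℝ) ^ (-α))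
      (fun n => ?_) (by simpa using h2.const_mul (1 + |l|))
    rw [norm_mul, Real.norm_eq_abs, Real.norm_eq_abs, abs_of_nonneg (by positivity :
      (0 : ℝ) ≤ ((n + τ : ℕ) : ℝ) ^ (-α))]
    gcongr
    refine (abs_add_le _ _).trans (add_le_add ?_ le_rfl)
    rw [abs_le]
    have := Int.floor_le (x * ((n + N : ℕ) : ℝ) ^ α)
    have := Int.lt_floor_add_one (x * ((n + N : ℕ) : ℝ) ^ α)
    constructor <;> linarith
  have h := h1.add h3
  rw [add_zero] at h
  refine h.congr fun n => ?_
  rw [Real.div_rpow (by positivity) (by positivity), Real.rpow_neg (by positivity)]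
  ring

theorem statement0
    (m : ℝ) (hm : 0 < m)
    (p : ℕ → ℤ → ℝ)
    (h0nonneg : ∀ k : ℤ, 0 ≤ p 0 k)
    (h0sum : HasSum (p 0) 1)
    (hrec : ∀ (n : ℕ) (k : ℤ),
      p (n + 1) k =
        p n k * (1 - p n k ^ m) + (1 / 2) * p n (k + 1) ^ (m + 1)
          + (1 / 2) * p n (k - 1) ^ (m + 1))
    (x : ℝ) :
    Tendsto
      (fun n : ℕ =>
        ∑' k : ℤ, if (k : ℝ) ≤ x * (n : ℝ) ^ (1 / (m + 2)) then p n k else 0)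
      atTop (nhds (limitCDF m x)) := by
  have hcdf : ∀ n : ℕ, (∑' k : ℤ, if (k : ℝ) ≤ x * (n : ℝ) ^ (1 / (m + 2)) then p n k else 0) =
      cdfSum (p n) ⌊x * (n : ℝ) ^ (1 / (m + 2))⌋ := fun n => by
    simp only [cdfSum, Int.le_floor]
  simp only [hcdf]
  rw [Metric.tendsto_nhds]
  intro ε hε
  obtain ⟨N, τ, L, H⟩ := IsScheme.exists_sandwich (p := p) hrec hm h0nonneg h0sum (half_pos hε)
  have hα : 0 < 1 / (m + 2) := by positivity
  have hcont : Tendsto (limitCDF m) (nhds x) (nhds (limitCDF m x)) :=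
    (hasDerivAt_limitCDF hm x).continuousAt
  have hu := (hcont.comp (tendsto_floor_add_mul_rpow hα x L N τ)).eventually_lt_const
    (show limitCDF m x < limitCDF m x + ε / 2 by linarith)
  have hl := (hcont.comp (tendsto_floor_add_mul_rpow hα x (-L) N τ)).eventually_const_lt
    (show limitCDF m x - ε / 2 < limitCDF m x by linarith)
  rw [← map_add_atTop_eq_nat N, eventually_map]
  filter_upwards [hu, hl] with n hn hn'
  obtain ⟨H1, H2⟩ := H n ⌊x * ((n + N : ℕ) : ℝ) ^ (1 / (m + 2))⌋
  simp only [Function.comp_apply] at hn hn'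
  rw [Real.dist_eq, abs_lt]
  constructor <;> linarith
end

section
/- Fix a real m > 0 and set p* = (m+1)^{−1/m}. There exists N = N(m) ∈ ℕ such that for every probability mass function p^0 on ℤ, defining p^n inductively by p^{n+1}_k = p^n_k(1 − (p^n_k)^m) + (1/2)(p^n_{k+1})^{m+1} + (1/2)(p^n_{k−1})^{m+1}, one has p^n_k ≤ p* for all n ≥ N and all k ∈ ℤ. -/
/-- The tangent line inequality for the strictly convex function `t ↦ t ^ (m + 1)`. -/
theorem tangent_lt_rpow {m a b : ℝ} (hm : 0 < m) (ha : 0 < a) (hb : 0 ≤ b) (hab : a ≠ b) :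
    a ^ (m + 1) + (m + 1) * a ^ m * (b - a) < b ^ (m + 1) := by
  have hs : -1 ≤ b / a - 1 := by
    have : 0 ≤ b / a := by positivity
    linarith
  have hs' : b / a - 1 ≠ 0 := by
    rw [sub_ne_zero, ne_eq, div_eq_one_iff_eq ha.ne']
    exact hab.symm
  have h := one_add_mul_self_lt_rpow_one_add hs hs' (show 1 < m + 1 by linarith)
  rw [add_sub_cancel, Real.div_rpow hb ha.le, lt_div_iff₀ (by positivity)] at h
  refine lt_of_eq_of_lt ?_ h
  rw [Real.rpow_add_one ha.ne']
  field_simp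

/-- The midpoint (Hermite–Hadamard) inequality for `t ↦ t ^ (m + 1)`, whose derivative is concave
for `m ≤ 1`. -/
theorem rpow_sub_rpow_le_midpoint {m x y : ℝ} (hm : 0 < m) (hm1 : m ≤ 1) (hx : 0 ≤ x)
    (hxy : x ≤ y) :
    y ^ (m + 1) - x ^ (m + 1) ≤ (m + 1) * ((x + y) / 2) ^ m * (y - x) := by
  set c := (x + y) / 2 with hc
  let φ : ℝ → ℝ := fun d => (c + d) ^ (m + 1) - (c - d) ^ (m + 1) - 2 * ((m + 1) * c ^ m) * d
  have hd : ∀ d, HasDerivAt φ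
      ((m + 1) * (c + d) ^ m + (m + 1) * (c - d) ^ m - 2 * ((m + 1) * c ^ m)) d := by
    intro d
    have h1 : HasDerivAt (fun d => (c + d) ^ (m + 1)) (1 * (m + 1) * (c + d) ^ (m + 1 - 1)) d :=
      ((hasDerivAt_id d).const_add c).rpow_const (Or.inr (by linarith))
    have h2 : HasDerivAt (fun d => (c - d) ^ (m + 1)) (-1 * (m + 1) * (c - d) ^ (m + 1 - 1)) d :=
      ((hasDerivAt_id d).const_sub c).rpow_const (Or.inr (by linarith))
    have h3 : HasDerivAt (fun d => 2 * ((m + 1) * c ^ m) * d) (2 * ((m + 1) * c ^ m) * 1) d :=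
      (hasDerivAt_id d).const_mul _
    refine ((h1.sub h2).sub h3).congr_deriv ?_
    rw [add_sub_cancel_right]
    ring
  have hanti : AntitoneOn φ (Set.Icc 0 c) := by
    refine antitoneOn_of_deriv_nonpos (convex_Icc 0 c)
      (fun d _ => (hd d).continuousAt.continuousWithinAt)
      (fun d _ => (hd d).differentiableAt.differentiableWithinAt) fun d hdm => ?_
    rw [interior_Icc] at hdm
    rw [(hd d).deriv]
    have hconc := (Real.concaveOn_rpow hm.le hm1).2
      (show c + d ∈ Set.Ici (0 : ℝ) by simp only [Set.mem_Ici]; linarith [hdm.1, hdm.2])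
      (show c - d ∈ Set.Ici (0 : ℝ) by simp only [Set.mem_Ici]; linarith [hdm.2])
      (show (0 : ℝ) ≤ 1 / 2 by norm_num) (show (0 : ℝ) ≤ 1 / 2 by norm_num) (by norm_num)
    simp only [smul_eq_mul] at hconc
    rw [show 1 / 2 * (c + d) + 1 / 2 * (c - d) = c by ring] at hconc
    nlinarith [hconc]
  have h := hanti (show (0 : ℝ) ∈ Set.Icc 0 c from ⟨le_rfl, by linarith⟩)
    (show (y - x) / 2 ∈ Set.Icc 0 c from ⟨by linarith, by linarith⟩)
    (by linarith : (0 : ℝ) ≤ (y - x) / 2)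
  simp only [φ] at h
  rw [show c + (y - x) / 2 = y by rw [hc]; ring, show c - (y - x) / 2 = x by rw [hc]; ring] at h
  simp only [add_zero, sub_zero, mul_zero, sub_self] at h
  linarith

theorem one_third_lt_of_mul_rpow_eq_one {m q : ℝ} (hm : 0 < m) (hq : 0 < q)
    (hqm : (m + 1) * q ^ m = 1) : 1 / 3 < q := by
  by_contra! h
  have h1 : q ^ m ≤ (1 / 3) ^ m := Real.rpow_le_rpow hq.le h hm.le
  have h2 : Real.exp m < 3 ^ m := by
    rw [Real.rpow_def_of_pos (by norm_num), Real.exp_lt_exp]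
    have : 1 < Real.log 3 := by
      rw [Real.lt_log_iff_exp_lt (by norm_num)]
      exact Real.exp_one_lt_three
    nlinarith
  have h3 := Real.add_one_le_exp m
  rw [Real.div_rpow (by norm_num) (by norm_num), Real.one_rpow,
    le_div_iff₀ (by positivity)] at h1
  have : 0 < q ^ m := by positivity
  nlinarith

theorem half_le_of_mul_rpow_eq_one {m q : ℝ} (hm : 1 ≤ m) (hq : 0 < q)
    (hqm : (m + 1) * q ^ m = 1) : 1 / 2 ≤ q := by
  by_contra! h
  have h1 : q ^ m < (1 / 2) ^ m := Real.rpow_lt_rpow hq.le h (by linarith)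
  have h2 := one_add_mul_self_le_rpow_one_add (s := 1) (by norm_num) hm
  rw [Real.div_rpow (by norm_num) (by norm_num), Real.one_rpow,
    lt_div_iff₀ (by positivity)] at h1
  have : 0 < q ^ m := by positivity
  norm_num at h2
  nlinarith

/-- For `m ≥ 1`, the function `t - t ^ (m + 1)` does not decrease under `x ↦ 1 - x` for
`x ≤ 1 / 2`. -/
theorem rpow_one_sub_sub_rpow_le {m x : ℝ} (hm : 1 ≤ m) (hx : 0 ≤ x) (hx2 : x < 1 / 2) :
    (1 - x) ^ (m + 1) - x ^ (m + 1) ≤ 1 - 2 * x := by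
  rcases hx.eq_or_lt with rfl | hx0
  · simp [Real.zero_rpow (show m + 1 ≠ 0 by linarith)]
  have h := (convexOn_rpow hm).secant_mono (a := 1) (x := x) (y := 1 - x)
    (by simp) (by simpa using hx) (by simp; linarith) (by linarith) (by linarith) (by linarith)
  simp only [Real.one_rpow] at h
  rw [← neg_div_neg_eq, ← neg_div_neg_eq ((1 - x) ^ m - 1),
    div_le_div_iff₀ (by linarith) (by linarith)] at h
  rw [Real.rpow_add_one hx0.ne', Real.rpow_add_one (by linarith)]
  linarith

theorem rpow_sub_rpow_le_of_one_le {m q x y : ℝ} (hm : 1 ≤ m) (hq : 0 < q)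
    (hqm : (m + 1) * q ^ m = 1) (hx : 0 ≤ x) (hqy : q < y) (hxy : x + y ≤ 1) :
    y ^ (m + 1) - x ^ (m + 1) ≤ y - x := by
  have hq2 := half_le_of_mul_rpow_eq_one hm hq hqm
  have h1 := rpow_one_sub_sub_rpow_le hm hx (by linarith)
  rcases (show y ≤ 1 - x by linarith).eq_or_lt with rfl | hlt
  · linarith
  have h2 := tangent_lt_rpow (zero_lt_one.trans_le hm) (hq.trans hqy)
    ((hq.trans hqy).trans hlt).le hlt.ne
  have h3 : q ^ m ≤ y ^ m := Real.rpow_le_rpow hq.le hqy.le (by linarith)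
  have h4 : 1 ≤ (m + 1) * y ^ m :=
    hqm.symm.trans_le (mul_le_mul_of_nonneg_left h3 (by linarith))
  nlinarith

theorem rpow_sub_rpow_lt {m q x y : ℝ} (hm : 0 < m) (hqm : (m + 1) * q ^ m = 1)
    (hx : 0 ≤ x) (hxy : x < y) (hyq : y ≤ q) :
    y ^ (m + 1) - x ^ (m + 1) < y - x := by
  have h1 := tangent_lt_rpow hm (hx.trans_lt hxy) hx hxy.ne'
  have h2 : y ^ m ≤ q ^ m := Real.rpow_le_rpow (by linarith) hyq hm.le
  have h3 : (m + 1) * y ^ m ≤ 1 :=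
    (mul_le_mul_of_nonneg_left h2 (by linarith)).trans_eq hqm
  nlinarith

theorem mul_rpow_le_of_le_half {m c : ℝ} (hm : 0 < m) (hm1 : m ≤ 1) (hc : 0 ≤ c)
    (hc2 : c ≤ 1 / 2) : (m + 1) * c ^ m ≤ 6 / 5 := by
  have h1 : c ^ m ≤ (1 / 2) ^ m := Real.rpow_le_rpow hc hc2 hm.le
  rw [Real.div_rpow (by norm_num) (by norm_num), Real.one_rpow,
    le_div_iff₀ (by positivity)] at h1
  have h2 : 1 + 0.69 * m ≤ (2 : ℝ) ^ m := by
    rw [Real.rpow_def_of_pos (by norm_num)]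
    have := Real.add_one_le_exp (Real.log 2 * m)
    nlinarith [Real.log_two_gt_d9]
  have : 0 ≤ c ^ m := by positivity
  nlinarith

theorem step_lt_of_lt_of_lt_one {m q x y z : ℝ} (hm : 0 < m) (hm1 : m < 1) (hq : 0 < q)
    (hqm : (m + 1) * q ^ m = 1) (hx : 0 ≤ x) (hz : 0 ≤ z) (hsum : x + y + z ≤ 1)
    (hzy : z ≤ y) (hxy : x < y) (hqy : q < y) :
    x - x ^ (m + 1) + 1 / 2 * y ^ (m + 1) + 1 / 2 * z ^ (m + 1) < y := by
  have hq3 := one_third_lt_of_mul_rpow_eq_one hm hq hqm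
  have hmid := rpow_sub_rpow_le_midpoint hm hm1.le hx hxy.le
  have hzy' : z ^ (m + 1) ≤ y ^ (m + 1) := Real.rpow_le_rpow hz hzy (by linarith)
  rcases lt_or_ge ((x + y) / 2) q with hcq | hcq
  · have h1 : ((x + y) / 2) ^ m < q ^ m := Real.rpow_lt_rpow (by linarith) hcq hm
    have h2 : (m + 1) * ((x + y) / 2) ^ m < 1 :=
      (mul_lt_mul_of_pos_left h1 (by linarith)).trans_eq hqm
    nlinarith
  · have h1 : (m + 1) * ((x + y) / 2) ^ m ≤ 6 / 5 :=
      mul_rpow_le_of_le_half hm hm1.le (by linarith) (by linarith)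
    have h2 : y ^ (m + 1) - x ^ (m + 1) ≤ 6 / 5 * (y - x) :=
      hmid.trans (mul_le_mul_of_nonneg_right h1 (by linarith))
    rcases le_or_gt z x with hzx | hxz
    · have : z ^ (m + 1) ≤ x ^ (m + 1) := Real.rpow_le_rpow hz hzx (by linarith)
      linarith
    · have := rpow_sub_rpow_lt hm hqm hx hxz (by linarith)
      linarith

theorem step_lt_of_le {m q x y z : ℝ} (hm : 0 < m) (hq : 0 < q)
    (hqm : (m + 1) * q ^ m = 1) (hx : 0 ≤ x) (hy : 0 ≤ y) (hz : 0 ≤ z)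
    (hsum : x + y + z ≤ 1) (hzy : z ≤ y) :
    x - x ^ (m + 1) + 1 / 2 * y ^ (m + 1) + 1 / 2 * z ^ (m + 1) < max (max x y) q := by
  have hm' : 0 < m + 1 := by linarith
  have hq3 := one_third_lt_of_mul_rpow_eq_one hm hq hqm
  rcases le_or_gt y x with hyx | hxy
  · have hyx' : y ^ (m + 1) ≤ x ^ (m + 1) := Real.rpow_le_rpow hy hyx hm'.le
    rcases (hzy.trans hyx).eq_or_lt with rfl | hzx
    · exact lt_max_of_lt_right (by linarith)
    · have := Real.rpow_lt_rpow hz hzx hm'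
      exact lt_max_of_lt_left (lt_max_of_lt_left (by linarith))
  refine lt_max_of_lt_left (lt_max_of_lt_right ?_)
  rcases le_or_gt y q with hyq | hqy
  · have h1 := rpow_sub_rpow_lt hm hqm hx hxy hyq
    have h2 : z ^ (m + 1) ≤ y ^ (m + 1) := Real.rpow_le_rpow hz hzy hm'.le
    linarith
  rcases lt_or_ge m 1 with hm1 | hm1
  · exact step_lt_of_lt_of_lt_one hm hm1 hq hqm hx hz hsum hzy hxy hqy
  · have h1 := rpow_sub_rpow_le_of_one_le hm1 hq hqm hx hqy (by linarith)
    have h2 := half_le_of_mul_rpow_eq_one hm1 hq hqm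
    have h3 : z ^ (m + 1) < y ^ (m + 1) := Real.rpow_lt_rpow hz (by linarith) hm'
    linarith

theorem step_lt_s2 {m q x y z : ℝ} (hm : 0 < m) (hq : 0 < q)
    (hqm : (m + 1) * q ^ m = 1) (hx : 0 ≤ x) (hy : 0 ≤ y) (hz : 0 ≤ z)
    (hsum : x + y + z ≤ 1) :
    x - x ^ (m + 1) + 1 / 2 * y ^ (m + 1) + 1 / 2 * z ^ (m + 1)
      < max (max x (max y z)) q := by
  rcases le_total z y with h | h
  · rw [max_eq_left h]
    exact step_lt_of_le hm hq hqm hx hy hz hsum h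
  · rw [max_eq_right h]
    linarith [step_lt_of_le hm hq hqm hx hz hy (by linarith) h]

/-- By compactness of the simplex, the gap in `step_lt` is bounded below. -/
theorem exists_step_le_sub_s2 {m q : ℝ} (hm : 0 < m) (hq : 0 < q) (hqm : (m + 1) * q ^ m = 1) :
    ∃ c > 0, ∀ x y z : ℝ, 0 ≤ x → 0 ≤ y → 0 ≤ z → x + y + z ≤ 1 →
      x - x ^ (m + 1) + 1 / 2 * y ^ (m + 1) + 1 / 2 * z ^ (m + 1)
        ≤ max (max x (max y z)) q - c := by
  let S : Set (ℝ × ℝ × ℝ) :=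
    Set.Icc 0 1 ∩ {v | v.1 + v.2.1 + v.2.2 ≤ 1}
  have hS : IsCompact S :=
    isCompact_Icc.inter_right (isClosed_le (by fun_prop) continuous_const)
  let G : ℝ × ℝ × ℝ → ℝ := fun v => max (max v.1 (max v.2.1 v.2.2)) q -
    (v.1 - v.1 ^ (m + 1) + 1 / 2 * v.2.1 ^ (m + 1) + 1 / 2 * v.2.2 ^ (m + 1))
  have hpow : Continuous fun t : ℝ => t ^ (m + 1) :=
    Real.continuous_rpow_const (by linarith)
  have hG : Continuous G := by
    have h1 := hpow.comp (continuous_fst (X := ℝ) (Y := ℝ × ℝ))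
    have h2 := hpow.comp (continuous_fst.comp (continuous_snd (X := ℝ) (Y := ℝ × ℝ)))
    have h3 := hpow.comp (continuous_snd.comp (continuous_snd (X := ℝ) (Y := ℝ × ℝ)))
    simp only [Function.comp_def] at h1 h2 h3
    fun_prop
  obtain ⟨v, hv, hmin⟩ := hS.exists_isMinOn
    ⟨0, ⟨⟨le_rfl, zero_le_one⟩, by simp⟩⟩ hG.continuousOn
  refine ⟨G v, ?_, fun x y z hx hy hz hsum => ?_⟩
  · obtain ⟨⟨⟨h1, h2, h3⟩, -⟩, h4⟩ := hv
    exact sub_pos.2 (step_lt_s2 hm hq hqm h1 h2 h3 h4)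
  · have hmem : (x, y, z) ∈ S :=
      ⟨⟨⟨hx, hy, hz⟩, ⟨by simp; linarith, by simp; linarith, by simp; linarith⟩⟩, hsum⟩
    have h : G v ≤ G (x, y, z) := hmin hmem
    simp only [G] at h ⊢
    linarith

theorem mul_one_sub_rpow {m x : ℝ} (hm : 0 < m) (hx : 0 ≤ x) :
    x * (1 - x ^ m) = x - x ^ (m + 1) := by
  rw [Real.rpow_add_one' hx (by linarith)]
  ring

/-- The recursion maps probability mass functions to probability mass functions. -/
theorem hasSum_step {m : ℝ} (hm : 0 < m) {p p' : ℤ → ℝ} (hp : ∀ k, 0 ≤ p k) (hs : HasSum p 1)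
    (hp' : ∀ k, p' k = p k * (1 - p k ^ m) + (1 / 2) * p (k + 1) ^ (m + 1)
      + (1 / 2) * p (k - 1) ^ (m + 1)) :
    (∀ k, 0 ≤ p' k) ∧ HasSum p' 1 := by
  have hle : ∀ k, p k ≤ 1 := fun k => le_hasSum hs k fun j _ => hp j
  have hpos : ∀ k, 0 ≤ p k ^ (m + 1) := fun k => Real.rpow_nonneg (hp k) _
  refine ⟨fun k => ?_, ?_⟩
  · rw [hp']
    have h1 : p k ^ m ≤ 1 := Real.rpow_le_one (hp k) (hle k) hm.le
    have := mul_nonneg (hp k) (sub_nonneg.2 h1)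
    linarith [hpos (k + 1), hpos (k - 1)]
  · have hsum : Summable fun k => p k ^ (m + 1) :=
      Summable.of_nonneg_of_le hpos
        (fun k => Real.rpow_le_self_of_le_one (hp k) (hle k) (by linarith)) hs.summable
    obtain ⟨s, hf⟩ := hsum
    have hr : HasSum (fun k => p (k + 1) ^ (m + 1)) s :=
      (Equiv.addRight (1 : ℤ)).hasSum_iff (f := fun k => p k ^ (m + 1)) |>.2 hf
    have hl : HasSum (fun k => p (k - 1) ^ (m + 1)) s :=
      (Equiv.subRight (1 : ℤ)).hasSum_iff (f := fun k => p k ^ (m + 1)) |>.2 hf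
    have h := ((hs.sub hf).add (hr.mul_left (1 / 2))).add (hl.mul_left (1 / 2))
    rw [show 1 - s + 1 / 2 * s + 1 / 2 * s = 1 by ring] at h
    rwa [funext fun k => (hp' k).trans (by rw [mul_one_sub_rpow hm (hp k)])]

theorem add_neighbours_le {p : ℤ → ℝ} (hp : ∀ k, 0 ≤ p k) (hs : HasSum p 1) (k : ℤ) :
    p k + p (k + 1) + p (k - 1) ≤ 1 := by
  have h := sum_le_hasSum {k, k + 1, k - 1} (fun j _ => hp j) hs
  rw [Finset.sum_insert (by simp; omega), Finset.sum_pair (by omega)] at h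
  linarith

theorem statement2 (m : ℝ) (hm : 0 < m) :
    ∃ N : ℕ, ∀ p : ℕ → ℤ → ℝ,
      (∀ k : ℤ, 0 ≤ p 0 k) → HasSum (p 0) 1 →
      (∀ (n : ℕ) (k : ℤ),
        p (n + 1) k =
          p n k * (1 - p n k ^ m) + (1 / 2) * p n (k + 1) ^ (m + 1)
            + (1 / 2) * p n (k - 1) ^ (m + 1)) →
      ∀ n ≥ N, ∀ k : ℤ, p n k ≤ (m + 1) ^ (-(1 / m) : ℝ) := by
  set q : ℝ := (m + 1) ^ (-(1 / m) : ℝ) with hqdef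
  have hm' : 0 < m + 1 := by linarith
  have hq : 0 < q := Real.rpow_pos_of_pos hm' _
  have hqm : (m + 1) * q ^ m = 1 := by
    rw [hqdef, ← Real.rpow_mul hm'.le, show -(1 / m) * m = -1 by field_simp, Real.rpow_neg_one,
      mul_inv_cancel₀ hm'.ne']
  obtain ⟨c, hc, hstep⟩ := exists_step_le_sub_s2 hm hq hqm
  obtain ⟨N, hN⟩ := exists_nat_ge (1 / c)
  refine ⟨N, fun p hp0 hs0 hrec n hn k => ?_⟩
  have hpmf : ∀ n, (∀ k, 0 ≤ p n k) ∧ HasSum (p n) 1 := by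
    intro n
    induction n with
    | zero => exact ⟨hp0, hs0⟩
    | succ n ih => exact hasSum_step hm ih.1 ih.2 (hrec n)
  have hbound : ∀ (n : ℕ) (k : ℤ), p n k ≤ max (1 - n * c) q := by
    intro n
    induction n with
    | zero => exact fun k => le_max_of_le_left (by simpa using le_hasSum hs0 k fun j _ => hp0 j)
    | succ n ih =>
      intro k
      have hpn := (hpmf n).1
      have h := hstep (p n k) (p n (k + 1)) (p n (k - 1)) (hpn _) (hpn _) (hpn _)
        (add_neighbours_le hpn (hpmf n).2 k)
      have hB := max_le (max_le (ih k) (max_le (ih (k + 1)) (ih (k - 1))))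
        (le_max_right (1 - n * c) q)
      rw [hrec, mul_one_sub_rpow hm (hpn k)]
      push_cast
      rcases le_total (1 - n * c) q with hle | hle
      · rw [max_eq_right hle] at hB
        exact le_max_of_le_right (by linarith)
      · rw [max_eq_left hle] at hB
        exact le_max_of_le_left (by linarith)
  refine (hbound n k).trans (max_le ?_ le_rfl)
  have hn' : (N : ℝ) ≤ n := by exact_mod_cast hn
  rw [div_le_iff₀ hc] at hN
  nlinarith
end

section
/- Fix a real m > 0 and set p* = (m+1)^{−1/m}. There exists a constant C > 0, depending only on m, with the following property: for every probability mass function p on ℤ and every k ∈ ℤ, if max(p_{k−1}, p_k, p_{k+1}) > p*, then p_k(1 − p_k^m) + (1/2)p_{k+1}^{m+1} + (1/2)p_{k−1}^{m+1} ≤ max(p_{k−1}, p_k, p_{k+1}) − C. -/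
theorem log_two_add_mul_add_mul_log_pos {x : ℝ} (hx : 0 ≤ x) (hx1 : x < 1) :
    0 < (1 - x) * Real.log (2 + x) + x * Real.log x := by
  obtain ⟨y, hy, rfl⟩ : ∃ y : ℝ, 0 ≤ y ∧ x = y ^ 2 :=
    ⟨√x, Real.sqrt_nonneg x, (Real.sq_sqrt hx).symm⟩
  have hy1 : y < 1 := by nlinarith
  have hlog2 := Real.log_two_gt_d9
  rcases hy.eq_or_lt with rfl | hy0
  · norm_num
    linarith
  have hsplit : Real.log (2 + y ^ 2) = Real.log 2 + Real.log (1 + y ^ 2 / 2) := by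
    rw [← Real.log_mul (by norm_num) (by positivity)]
    congr 1
    ring
  have hbound := Real.le_log_one_add_of_nonneg (show 0 ≤ y ^ 2 / 2 by positivity)
  have hlower : 0.69 + 2 * y ^ 2 / (4 + y ^ 2) < Real.log (2 + y ^ 2) := by
    have : 2 * (y ^ 2 / 2) / (y ^ 2 / 2 + 2) = 2 * y ^ 2 / (4 + y ^ 2) := by
      field_simp
      ring
    linarith
  have hrational : 2 * y / (1 + y) < 0.69 + 2 * y ^ 2 / (4 + y ^ 2) := by
    rw [div_lt_iff₀ (by positivity)]
    have : (0.69 + 2 * y ^ 2 / (4 + y ^ 2)) * (1 + y)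
        = (0.69 * (4 + y ^ 2) + 2 * y ^ 2) * (1 + y) / (4 + y ^ 2) := by
      field_simp
    rw [this, lt_div_iff₀ (by positivity)]
    nlinarith [sq_nonneg (y - 0.8), mul_nonneg hy (sq_nonneg (y - 0.8)),
      mul_nonneg hy (sq_nonneg (y - 0.9)), sq_nonneg (y - 0.9)]
  have hlogy : -(1 / y - 1) ≤ Real.log y := by
    have := Real.log_le_sub_one_of_pos (show 0 < y⁻¹ by positivity)
    rw [Real.log_inv] at this
    rw [one_div]
    linarith
  have hentropy : -(2 * y * (1 - y)) ≤ y ^ 2 * Real.log (y ^ 2) := by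
    rw [Real.log_pow]
    have := mul_le_mul_of_nonneg_left hlogy (show 0 ≤ 2 * y ^ 2 by positivity)
    have heq : 2 * y ^ 2 * -(1 / y - 1) = -(2 * y * (1 - y)) := by
      field_simp
    push_cast
    linarith
  have hmul := mul_lt_mul_of_pos_left (hrational.trans hlower)
    (show 0 < 1 - y ^ 2 by linarith)
  have heq : (1 - y ^ 2) * (2 * y / (1 + y)) = 2 * y * (1 - y) := by
    field_simp
    ring
  linarith

theorem one_add_mul_log_le_rpow {x : ℝ} (hx : 0 < x) (m : ℝ) :
    1 + m * Real.log x ≤ x ^ m := by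
  rw [Real.rpow_def_of_pos hx]
  linarith [Real.add_one_le_exp (Real.log x * m)]

theorem one_lt_mul_two_add_rpow_add_rpow {m x : ℝ} (hm : 0 < m) (hx : 0 ≤ x) (hx1 : x < 1) :
    1 < (1 - x) * (2 + x) ^ m + x ^ (m + 1) := by
  have hpow : x * (1 + m * Real.log x) ≤ x ^ (m + 1) := by
    rcases hx.eq_or_lt with rfl | hx0
    · simpa using Real.zero_rpow_nonneg (m + 1)
    · rw [Real.rpow_add_one hx0.ne', mul_comm]
      gcongr
      exact one_add_mul_log_le_rpow hx0 m
  have hpow' := mul_le_mul_of_nonneg_left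
    (one_add_mul_log_le_rpow (show 0 < 2 + x by linarith) m) (sub_nonneg.2 hx1.le)
  nlinarith [mul_pos hm (log_two_add_mul_add_mul_log_pos hx hx1)]

theorem half_one_add_rpow_lt_of_one_le {m x y : ℝ} (hm : 1 ≤ m) (hx : 0 ≤ x) (hx1 : x < 1)
    (hy : 0 ≤ y) (hy1 : y ≤ 1) :
    (1 + y ^ (m + 1)) / 2 < (1 - x) * (1 + x + y) ^ m + x ^ (m + 1) := by
  have hypow : y ^ (m + 1) ≤ y :=
    Real.rpow_le_self_of_le_one hy hy1 (by linarith)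
  have hxpow : 1 + (m + 1) * (x - 1) ≤ x ^ (m + 1) := by
    have := one_add_mul_self_le_rpow_one_add (show -1 ≤ x - 1 by linarith)
      (show 1 ≤ m + 1 by linarith)
    simpa using this
  have hxpow0 : 0 ≤ x ^ (m + 1) := Real.rpow_nonneg hx _
  have hsum : 1 + m * (x + y) ≤ (1 + x + y) ^ m := by
    have := one_add_mul_self_le_rpow_one_add (show -1 ≤ x + y by linarith) hm
    rwa [← add_assoc] at this
  obtain ⟨t, rfl⟩ : ∃ t : ℝ, x = 1 - t := ⟨1 - x, by ring⟩
  have ht : 0 < t := by linarith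
  have hmul := mul_le_mul_of_nonneg_left hsum ht.le
  rw [sub_sub_cancel]
  have hmt : 0 < m * t := by positivity
  rcases le_or_gt (1 / 2) t with h | h
  · have h1 : 0 ≤ y * (m * t - 1 / 2) := mul_nonneg hy (by nlinarith)
    have h2 : 0 < t - 1 / 2 + m * t * (1 - t) := by
      rcases h.eq_or_lt with rfl | h
      · linarith
      · nlinarith [mul_nonneg hmt.le hx]
    nlinarith
  · rcases le_or_gt (1 / 2) (m * t) with h' | h'
    · have h1 : 0 ≤ y * (m * t - 1 / 2) := mul_nonneg hy (by linarith)
      by_cases hlarge : 0 < t - 1 / 2 + m * t * (1 - t)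
      · nlinarith
      · have h2 : m * t ≤ 1 - 2 * t := by nlinarith
        nlinarith [mul_le_mul_of_nonneg_right h2 ht.le, sq_nonneg (t - 1 / 4)]
    · nlinarith [mul_nonneg (sub_nonneg.2 hy1) (show 0 ≤ 1 / 2 - m * t by linarith),
        mul_pos hmt (show 0 < 1 - t by linarith)]

theorem half_one_add_rpow_lt_of_le_one {m x y : ℝ} (hm : 0 < m) (hm1 : m ≤ 1) (hx : 0 ≤ x)
    (hx1 : x < 1) (hy : 0 ≤ y) (hy1 : y ≤ 1) :
    (1 + y ^ (m + 1)) / 2 < (1 - x) * (1 + x + y) ^ m + x ^ (m + 1) := by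
  have hypow : y ^ (m + 1) ≤ y :=
    Real.rpow_le_self_of_le_one hy hy1 (by linarith)
  have hconcave : (1 - y) * (1 + x) ^ m + y * (2 + x) ^ m ≤ (1 + x + y) ^ m := by
    have := (Real.concaveOn_rpow hm.le hm1).2 (show 1 + x ∈ Set.Ici (0 : ℝ) by
      simp only [Set.mem_Ici]; linarith) (show 2 + x ∈ Set.Ici (0 : ℝ) by
      simp only [Set.mem_Ici]; linarith) (sub_nonneg.2 hy1) hy (by ring)
    simp only [smul_eq_mul] at this
    rwa [show (1 - y) * (1 + x) + y * (2 + x) = 1 + x + y by ring] at this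
  have hone : 1 ≤ (1 + x) ^ m := Real.one_le_rpow (by linarith) hm.le
  have hsq : x ^ 2 ≤ x ^ (m + 1) := by
    rw [← Real.rpow_two]
    exact Real.rpow_le_rpow_of_exponent_ge_of_imp hx hx1.le (by linarith)
      (fun _ h => by linarith)
  have hleft : 1 / 2 < (1 - x) * (1 + x) ^ m + x ^ (m + 1) := by
    nlinarith [mul_le_mul_of_nonneg_left hone (sub_nonneg.2 hx1.le), sq_nonneg (x - 1 / 2)]
  have hright := one_lt_mul_two_add_rpow_add_rpow hm hx hx1
  have hmul := mul_le_mul_of_nonneg_left hconcave (sub_nonneg.2 hx1.le)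
  rcases hy.eq_or_lt with rfl | hy0
  · nlinarith
  · nlinarith [mul_le_mul_of_nonneg_left hleft.le (sub_nonneg.2 hy1),
      mul_lt_mul_of_pos_left hright hy0]

theorem half_one_add_rpow_lt {m x y : ℝ} (hm : 0 < m) (hx : 0 ≤ x) (hx1 : x < 1)
    (hy : 0 ≤ y) (hy1 : y ≤ 1) :
    (1 + y ^ (m + 1)) / 2 < (1 - x) * (1 + x + y) ^ m + x ^ (m + 1) := by
  rcases le_total 1 m with h | h
  · exact half_one_add_rpow_lt_of_one_le h hx hx1 hy hy1
  · exact half_one_add_rpow_lt_of_le_one hm h hx hx1 hy hy1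

theorem update_lt_of_side_max {m a b c : ℝ} (hm : 0 < m) (ha : 0 ≤ a) (hb : 0 ≤ b)
    (hsum : a + b + c ≤ 1) (hac : a ≤ c) (hbc : b < c) :
    b - b ^ (m + 1) + (1 / 2) * c ^ (m + 1) + (1 / 2) * a ^ (m + 1) < c := by
  have hc : 0 < c := hb.trans_lt hbc
  have h := half_one_add_rpow_lt hm (div_nonneg hb hc.le) ((div_lt_one hc).2 hbc)
    (div_nonneg ha hc.le) ((div_le_one hc).2 hac)
  have hcm : 0 < c ^ m := Real.rpow_pos_of_pos hc m
  have hsum' : 1 + b / c + a / c = (a + b + c) / c := by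
    field_simp
    ring
  rw [hsum', Real.div_rpow ha hc.le, Real.div_rpow hb hc.le,
    Real.div_rpow (by linarith) hc.le, Real.rpow_add_one hc.ne'] at h
  have h' := mul_lt_mul_of_pos_right h (mul_pos hcm hc)
  have hl : (1 + a ^ (m + 1) / (c ^ m * c)) / 2 * (c ^ m * c)
      = (c ^ m * c + a ^ (m + 1)) / 2 := by
    field_simp
  have hr : ((1 - b / c) * ((a + b + c) ^ m / c ^ m) + b ^ (m + 1) / (c ^ m * c)) * (c ^ m * c)
      = (c - b) * (a + b + c) ^ m + b ^ (m + 1) := by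
    field_simp
  rw [hl, hr] at h'
  rw [Real.rpow_add_one hc.ne']
  have hone : (a + b + c) ^ m ≤ 1 := Real.rpow_le_one (by linarith) hsum hm.le
  nlinarith [mul_le_mul_of_nonneg_left hone (sub_nonneg.2 hbc.le)]

theorem update_lt_of_center_max {m a b c : ℝ} (hm : 0 < m) (ha : 0 ≤ a) (hc : 0 ≤ c)
    (hsum : a + b + c ≤ 1) (hab : a ≤ b) (hcb : c ≤ b) (hb : 1 / 3 < b) :
    b - b ^ (m + 1) + (1 / 2) * c ^ (m + 1) + (1 / 2) * a ^ (m + 1) < b := by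
  have hm1 : 0 < m + 1 := by linarith
  have ha' := Real.rpow_le_rpow ha hab hm1.le
  have hc' := Real.rpow_le_rpow hc hcb hm1.le
  rcases hab.eq_or_lt with rfl | hab
  · have := Real.rpow_lt_rpow hc (show c < a by linarith) hm1
    linarith
  · have := Real.rpow_lt_rpow ha hab hm1
    linarith

theorem update_lt_max {m a b c : ℝ} (hm : 0 < m) (ha : 0 ≤ a) (hb : 0 ≤ b) (hc : 0 ≤ c)
    (hsum : a + b + c ≤ 1) (hmax : 1 / 3 < max a (max b c)) :
    b - b ^ (m + 1) + (1 / 2) * c ^ (m + 1) + (1 / 2) * a ^ (m + 1) < max a (max b c) := by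
  by_cases hcenter : a ≤ b ∧ c ≤ b
  · obtain ⟨hab, hcb⟩ := hcenter
    rw [max_eq_left hcb, max_eq_right hab] at hmax ⊢
    exact update_lt_of_center_max hm ha hc hsum hab hcb hmax
  rcases le_total a c with hac | hca
  · have hbc : b < c := by grind
    exact (update_lt_of_side_max hm ha hb hsum hac hbc).trans_le (by simp)
  · have hba : b < a := by grind
    have := update_lt_of_side_max hm hc hb (by linarith) hca hba
    linarith [le_max_left a (max b c)]

theorem one_third_lt_rpow_neg_inv {m : ℝ} (hm : 0 < m) :
    (1 / 3 : ℝ) < (m + 1) ^ (-(1 / m) : ℝ) := by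
  have hlog : 1 < Real.log 3 :=
    (Real.lt_log_iff_exp_lt (by norm_num)).2 Real.exp_one_lt_three
  have hpow : m + 1 < 3 ^ m := by
    nlinarith [one_add_mul_log_le_rpow (show (0 : ℝ) < 3 by norm_num) m]
  have hroot := Real.rpow_lt_rpow (by linarith) hpow (show 0 < 1 / m by positivity)
  rw [← Real.rpow_mul (by norm_num), mul_one_div_cancel hm.ne', Real.rpow_one] at hroot
  rw [Real.rpow_neg (by linarith), ← one_div]
  exact one_div_lt_one_div_of_lt (Real.rpow_pos_of_pos (by linarith) _) hroot

theorem exists_update_le_max_sub {m s : ℝ} (hm : 0 < m) (hs : 1 / 3 < s) :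
    ∃ C : ℝ, 0 < C ∧ ∀ a b c : ℝ, 0 ≤ a → 0 ≤ b → 0 ≤ c → a + b + c ≤ 1 →
      s ≤ max a (max b c) →
      b - b ^ (m + 1) + (1 / 2) * c ^ (m + 1) + (1 / 2) * a ^ (m + 1)
        ≤ max a (max b c) - C := by
  have hm1 : 0 ≤ m + 1 := by linarith
  let gap : ℝ × ℝ × ℝ → ℝ := fun q => max q.1 (max q.2.1 q.2.2) -
    (q.2.1 - q.2.1 ^ (m + 1) + (1 / 2) * q.2.2 ^ (m + 1) + (1 / 2) * q.1 ^ (m + 1))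
  have hgap : Continuous gap := by
    have hpow : Continuous fun x : ℝ => x ^ (m + 1) := Real.continuous_rpow_const hm1
    fun_prop
  let K : Set (ℝ × ℝ × ℝ) := Set.Icc 0 1 ∩
    {q | q.1 + q.2.1 + q.2.2 ≤ 1 ∧ s ≤ max q.1 (max q.2.1 q.2.2)}
  have hK : IsCompact K := by
    have hsum : Continuous fun q : ℝ × ℝ × ℝ => q.1 + q.2.1 + q.2.2 := by fun_prop
    have hmax : Continuous fun q : ℝ × ℝ × ℝ => max q.1 (max q.2.1 q.2.2) := by fun_prop
    exact isCompact_Icc.inter_right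
      ((isClosed_le hsum continuous_const).inter (isClosed_le continuous_const hmax))
  have hmem : ∀ a b c : ℝ, 0 ≤ a → 0 ≤ b → 0 ≤ c → a + b + c ≤ 1 →
      s ≤ max a (max b c) → (a, b, c) ∈ K := fun a b c ha hb hc hsum hmax =>
    ⟨⟨⟨ha, hb, hc⟩, ⟨show a ≤ 1 by linarith, show b ≤ 1 by linarith,
      show c ≤ 1 by linarith⟩⟩, hsum, hmax⟩
  rcases K.eq_empty_or_nonempty with hempty | hne
  · refine ⟨1, one_pos, fun a b c ha hb hc hsum hmax => ?_⟩
    exact absurd (hempty ▸ hmem a b c ha hb hc hsum hmax) (Set.notMem_empty _)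
  · obtain ⟨q, ⟨⟨hq0, -⟩, hqsum, hqmax⟩, hmin⟩ := hK.exists_isMinOn hne hgap.continuousOn
    refine ⟨gap q, sub_pos.2 (update_lt_max hm hq0.1 hq0.2.1 hq0.2.2 hqsum
      (hs.trans_le hqmax)), fun a b c ha hb hc hsum hmax => ?_⟩
    have : gap q ≤ max a (max b c) -
        (b - b ^ (m + 1) + (1 / 2) * c ^ (m + 1) + (1 / 2) * a ^ (m + 1)) :=
      hmin (hmem a b c ha hb hc hsum hmax)
    linarith

theorem statement3 (m : ℝ) (hm : 0 < m) :
    ∃ C : ℝ, 0 < C ∧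
      ∀ p : ℤ → ℝ, (∀ k : ℤ, 0 ≤ p k) → HasSum p 1 →
        ∀ k : ℤ,
          (m + 1) ^ (-(1 / m) : ℝ) < max (p (k - 1)) (max (p k) (p (k + 1))) →
          p k * (1 - p k ^ m) + (1 / 2) * p (k + 1) ^ (m + 1)
              + (1 / 2) * p (k - 1) ^ (m + 1)
            ≤ max (p (k - 1)) (max (p k) (p (k + 1))) - C := by
  obtain ⟨C, hC, h⟩ := exists_update_le_max_sub hm (one_third_lt_rpow_neg_inv hm)
  refine ⟨C, hC, fun p hp hsum k hmax => ?_⟩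
  have hthree : p (k - 1) + p k + p (k + 1) ≤ 1 := by
    have := sum_le_hasSum {k - 1, k, k + 1} (fun i _ => hp i) hsum
    rw [Finset.sum_insert (by simp; omega), Finset.sum_insert (by simp),
      Finset.sum_singleton] at this
    linarith
  have hpow : p k * (1 - p k ^ m) = p k - p k ^ (m + 1) := by
    rw [Real.rpow_add_one' (hp k) (by linarith)]
    ring
  rw [hpow]
  exact h _ _ _ (hp _) (hp _) (hp _) hthree hmax.le
end
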